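/- Let h be a hyperexponential term given in standard form h = c0·exp(a/b)·∏_{ℓ=1}^L c_ℓ^{e_ℓ} satisfying the nondegeneracy assumptions, with deg_x a ≤ deg_x b. Suppose ω = deg_x c0 + Σ_{ℓ=1}^L e_ℓ·deg_x c_ℓ is the image in K of a natural number (identified with it) and γ − 1 + φ3 > ω. Set δ = ω + 1, ψ = γ + φ3 − 2, ϑ = α·(2γ−1+φ3) − 1, and φ' = deg_x c0 + α·deg_y c0 + (γ−2+φ3)·(deg_x c0 + 1 − α) − (1/2)·max{γ−2+φ3, 0}·(γ+1+φ3) − δ·(γ−2+φ3−ω) + 1. Then for all integers r and d with r ≥ ψ + 1 and d > (ϑ·r + φ')/(r − ψ), there exists a creative telescoping relation for h of order at most r and degree at most d. -/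

import Mathlib

open Polynomial Finset

/-- The derivative with respect to `y` on `K[y][x]`
(we represent bivariate polynomials as `Polynomial (Polynomial K)`,
the *outer* variable being `x`, the *inner* variable being `y`). -/
noncomputable def DY {K : Type*} [CommRing K] (p : Polynomial (Polynomial K)) :
    Polynomial (Polynomial K) :=
  p.sum fun n a => Polynomial.C (Polynomial.derivative a) * Polynomial.X ^ n

/-- The degree with respect to `y` of an element of `K[y][x]`. -/
noncomputable def degY {K : Type*} [CommRing K] (p : Polynomial (Polynomial K)) : ℕ :=
  p.support.sup fun n => (p.coeff n).natDegree

/-- The embedding of `K[x]` into `K[y][x]` (polynomials free of `y`). -/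
noncomputable def liftX {K : Type*} [CommRing K] (p : Polynomial K) :
    Polynomial (Polynomial K) :=
  p.map (Polynomial.C : K →+* Polynomial K)

/-- The falling factorial `z(z-1)⋯(z-n+1)` of an element of `K`. -/
noncomputable def ffall {K : Type*} [Field K] (z : K) (n : ℕ) : K :=
  ∏ j ∈ Finset.range n, (z - (j : K))

/-! ### Degree bounds by integers -/

/-- The degree of `p` is at most the integer `z` (so `p = 0` when `z < 0`). -/
def DegLE {S : Type*} [Semiring S] (p : Polynomial S) (z : ℤ) : Prop :=
  ∀ n : ℕ, z < n → p.coeff n = 0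

namespace DegLE

section Ring

variable {S : Type*} [CommRing S] {p q : Polynomial S} {z w : ℤ}

lemma mono (h : DegLE p z) (hzw : z ≤ w) : DegLE p w :=
  fun n hn => h n (hzw.trans_lt hn)

lemma zero : DegLE (0 : Polynomial S) z := fun _ _ => coeff_zero _

lemma natDegree : DegLE p p.natDegree :=
  fun _ hn => coeff_eq_zero_of_natDegree_lt (by exact_mod_cast hn)

lemma add (hp : DegLE p z) (hq : DegLE q z) : DegLE (p + q) z :=
  fun n hn => by rw [coeff_add, hp n hn, hq n hn, add_zero]

lemma sub (hp : DegLE p z) (hq : DegLE q z) : DegLE (p - q) z :=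
  fun n hn => by rw [coeff_sub, hp n hn, hq n hn, sub_zero]

lemma smul {A : Type*} [SMulZeroClass A S] (a : A) (hp : DegLE p z) : DegLE (a • p) z :=
  fun n hn => by rw [coeff_smul, hp n hn, smul_zero]

lemma mul (hp : DegLE p z) (hq : DegLE q w) : DegLE (p * q) (z + w) := by
  intro n hn
  rw [coeff_mul]
  refine Finset.sum_eq_zero fun x hx => ?_
  rw [HasAntidiagonal.mem_antidiagonal] at hx
  by_cases h : z < x.1
  · rw [hp _ h, zero_mul]
  · rw [hq x.2 (by omega), mul_zero]

lemma sum {α : Type*} {s : Finset α} {f : α → Polynomial S} (h : ∀ i ∈ s, DegLE (f i) z) :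
    DegLE (∑ i ∈ s, f i) z := by
  intro n hn
  rw [finsetSum_coeff]
  exact Finset.sum_eq_zero fun i hi => h i hi n hn

lemma one : DegLE (1 : Polynomial S) 0 := by
  intro n hn
  rw [coeff_one, if_neg (by omega)]

lemma X_pow (i : ℕ) : DegLE (X ^ i : Polynomial S) i := by
  intro n hn
  rw [coeff_X_pow, if_neg (by omega)]

lemma prod {α : Type*} {s : Finset α} {f : α → Polynomial S} {g : α → ℤ}
    (h : ∀ i ∈ s, DegLE (f i) (g i)) : DegLE (∏ i ∈ s, f i) (∑ i ∈ s, g i) := by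
  classical
  induction s using Finset.induction_on with
  | empty => simpa using one
  | insert i s hi ih =>
    rw [Finset.prod_insert hi, Finset.sum_insert hi]
    exact (h i (Finset.mem_insert_self _ _)).mul
      (ih fun j hj => h j (Finset.mem_insert_of_mem hj))

lemma pow (hp : DegLE p z) (n : ℕ) : DegLE (p ^ n) (n * z) := by
  induction n with
  | zero => simpa using one
  | succ n ih =>
    rw [pow_succ]
    exact (ih.mul hp).mono (by push_cast; linarith)

lemma derivative (hp : DegLE p z) : DegLE (derivative p) (z - 1) := by
  intro n hn
  rw [coeff_derivative, hp (n + 1) (by push_cast; linarith), zero_mul]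

lemma of_X_mul (hp : DegLE (X * p) z) : DegLE p (z - 1) := by
  intro n hn
  rw [← coeff_X_mul]
  exact hp (n + 1) (by push_cast; linarith)

/-- The operator `x · d/dx - m` lowers the degree of a polynomial of degree `m`. -/
lemma X_mul_derivative_sub (hp : DegLE p z) :
    DegLE (X * Polynomial.derivative p - (z : Polynomial S) * p) (z - 1) := by
  intro n hn
  have hX : (X * Polynomial.derivative p).coeff n = p.coeff n * n := by
    cases n with
    | zero => simp
    | succ n => rw [coeff_X_mul, coeff_derivative]; push_cast; ring
  rw [coeff_sub, hX, coeff_intCast_mul]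
  rcases eq_or_lt_of_le (show z ≤ n by omega) with h | h
  · subst h; push_cast; ring
  · rw [hp n h]; ring

end Ring

lemma of_mul {S : Type*} [CommRing S] [IsDomain S] {p q : Polynomial S} {z : ℤ} (hp : p ≠ 0)
    (h : DegLE (p * q) (p.natDegree + z)) : DegLE q z := by
  by_cases hq : q = 0
  · rw [hq]; exact zero
  have h1 : ((p.natDegree + q.natDegree : ℕ) : ℤ) ≤ p.natDegree + z := by
    by_contra hcon
    have := h (p.natDegree + q.natDegree) (not_le.mp hcon)
    rw [coeff_mul_degree_add_degree] at this
    exact mul_ne_zero (leadingCoeff_ne_zero.mpr hp) (leadingCoeff_ne_zero.mpr hq) this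
  exact natDegree.mono (by push_cast at h1; linarith)

end DegLE

/-! ### The `y`-direction -/

section Bivariate

variable {K : Type*} [CommRing K]

lemma coeff_coeff_swap (p : Polynomial (Polynomial K)) (m n : ℕ) :
    ((Bivariate.swap p).coeff m).coeff n = (p.coeff n).coeff m := by
  induction p using Polynomial.induction_on' with
  | add p q hp hq => simp only [map_add, coeff_add, hp, hq]
  | monomial i f =>
    induction f using Polynomial.induction_on' with
    | add f g hf hg => simp only [map_add, coeff_add, hf, hg]
    | monomial j a =>
      rw [Bivariate.swap_monomial_monomial]
      simp only [coeff_monomial]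
      split_ifs <;> simp_all [coeff_monomial]

lemma coeff_DY (p : Polynomial (Polynomial K)) (n : ℕ) :
    (DY p).coeff n = derivative (p.coeff n) := by
  rw [DY, Polynomial.sum, finsetSum_coeff]
  simp only [coeff_C_mul, coeff_X_pow, mul_ite, mul_one, mul_zero]
  rw [Finset.sum_ite_eq]
  split_ifs with h
  · rfl
  · rw [notMem_support_iff.mp h, derivative_zero]

lemma swap_DY (p : Polynomial (Polynomial K)) :
    Bivariate.swap (DY p) = derivative (Bivariate.swap p) := by
  ext m n
  rw [coeff_coeff_swap, coeff_DY, coeff_derivative, coeff_derivative]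
  have : ((m : Polynomial K) + 1) = C ((m : K) + 1) := by simp
  rw [this, coeff_mul_C, coeff_coeff_swap]

/-- Partial differentiation with respect to the outer variable `x`. -/
noncomputable def derivX (K : Type*) [CommRing K] :
    Derivation K (Polynomial (Polynomial K)) (Polynomial (Polynomial K)) :=
  (Polynomial.derivative' (R := Polynomial K)).restrictScalars K

/-- Partial differentiation with respect to the inner variable `y`. -/
noncomputable def derivY (K : Type*) [CommRing K] :
    Derivation K (Polynomial (Polynomial K)) (Polynomial (Polynomial K)) :=
  Derivation.mk'
    { toFun := DY
      map_add' := fun p q => by ext1 n; simp [coeff_DY]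
      map_smul' := fun a p => by ext1 n; simp [coeff_DY] }
    (fun p q => by
      apply (Bivariate.swap (R := K)).injective
      simp [swap_DY, derivative_mul, mul_comm, add_comm])

@[simp] lemma derivX_apply (p : Polynomial (Polynomial K)) : derivX K p = derivative p := rfl

@[simp] lemma derivY_apply (p : Polynomial (Polynomial K)) : derivY K p = DY p := rfl

lemma degY_eq (p : Polynomial (Polynomial K)) : degY p = (Bivariate.swap p).natDegree := by
  apply le_antisymm
  · refine Finset.sup_le fun n _ => natDegree_le_iff_coeff_eq_zero.mpr fun m hm => ?_
    rw [← coeff_coeff_swap, coeff_eq_zero_of_natDegree_lt hm, coeff_zero]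
  · refine natDegree_le_iff_coeff_eq_zero.mpr fun m hm => ?_
    ext n
    rw [coeff_coeff_swap, coeff_zero]
    by_cases hn : n ∈ p.support
    · exact coeff_eq_zero_of_natDegree_lt
        ((Finset.le_sup (f := fun n => (p.coeff n).natDegree) hn).trans_lt hm)
    · rw [notMem_support_iff.mp hn, coeff_zero]

/-- The `y`-degree of `p` is at most the integer `z`. -/
def YDegLE (p : Polynomial (Polynomial K)) (z : ℤ) : Prop := DegLE (Bivariate.swap p) z

namespace YDegLE

variable {p q : Polynomial (Polynomial K)} {z w : ℤ}

lemma mono (h : YDegLE p z) (hzw : z ≤ w) : YDegLE p w := DegLE.mono h hzw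

lemma degY : YDegLE p (degY p) := by
  rw [degY_eq]; exact DegLE.natDegree

lemma add (hp : YDegLE p z) (hq : YDegLE q z) : YDegLE (p + q) z := by
  unfold YDegLE; rw [map_add]; exact DegLE.add hp hq

lemma sub (hp : YDegLE p z) (hq : YDegLE q z) : YDegLE (p - q) z := by
  unfold YDegLE; rw [map_sub]; exact DegLE.sub hp hq

lemma smul (a : K) (hp : YDegLE p z) : YDegLE (a • p) z := by
  unfold YDegLE; rw [map_smul]; exact DegLE.smul a hp

lemma mul (hp : YDegLE p z) (hq : YDegLE q w) : YDegLE (p * q) (z + w) := by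
  unfold YDegLE; rw [map_mul]; exact DegLE.mul hp hq

lemma pow (hp : YDegLE p z) (n : ℕ) : YDegLE (p ^ n) (n * z) := by
  unfold YDegLE; rw [map_pow]; exact DegLE.pow hp n

lemma sum {α : Type*} {s : Finset α} {f : α → Polynomial (Polynomial K)}
    (h : ∀ i ∈ s, YDegLE (f i) z) : YDegLE (∑ i ∈ s, f i) z := by
  unfold YDegLE; rw [map_sum]; exact DegLE.sum h

lemma prod {α : Type*} {s : Finset α} {f : α → Polynomial (Polynomial K)} {g : α → ℤ}
    (h : ∀ i ∈ s, YDegLE (f i) (g i)) : YDegLE (∏ i ∈ s, f i) (∑ i ∈ s, g i) := by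
  unfold YDegLE; rw [map_prod]; exact DegLE.prod h

lemma DY (hp : YDegLE p z) : YDegLE (DY p) (z - 1) := by
  unfold YDegLE; rw [swap_DY]; exact DegLE.derivative hp

lemma iff_coeff : YDegLE p z ↔ ∀ n m : ℕ, z < m → (p.coeff n).coeff m = 0 := by
  constructor
  · intro h n m hm
    rw [← coeff_coeff_swap, h m hm, coeff_zero]
  · intro h m hm
    ext n
    rw [coeff_coeff_swap, h n m hm, coeff_zero]

lemma derivative (hp : YDegLE p z) : YDegLE (derivative p) z := by
  rw [iff_coeff] at hp ⊢
  intro n m hm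
  have : ((n : Polynomial K) + 1) = C ((n : K) + 1) := by simp
  rw [coeff_derivative, this, coeff_mul_C, hp _ _ hm, zero_mul]

lemma natCast_mul (n : ℕ) (hp : YDegLE p z) : YDegLE ((n : Polynomial (Polynomial K)) * p) z := by
  rw [← nsmul_eq_mul, ← Nat.cast_smul_eq_nsmul K]
  exact hp.smul _

lemma of_mul [IsDomain K] (hp : p ≠ 0) (h : YDegLE (p * q) (_root_.degY p + z)) : YDegLE q z := by
  unfold YDegLE at h
  rw [map_mul, degY_eq] at h
  exact DegLE.of_mul ((map_ne_zero_iff _ (Bivariate.swap (R := K)).injective).mpr hp) h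

end YDegLE

lemma DegLE.DY {p : Polynomial (Polynomial K)} {z : ℤ} (hp : DegLE p z) : DegLE (DY p) z := by
  intro n hn
  rw [coeff_DY, hp n hn, derivative_zero]

lemma DegLE.natCast_mul {p : Polynomial (Polynomial K)} {z : ℤ} (n : ℕ) (hp : DegLE p z) :
    DegLE ((n : Polynomial (Polynomial K)) * p) z := by
  rw [← nsmul_eq_mul, ← Nat.cast_smul_eq_nsmul K]
  exact hp.smul _

lemma degY_mul [IsDomain K] {p q : Polynomial (Polynomial K)} (hp : p ≠ 0) (hq : q ≠ 0) :
    degY (p * q) = degY p + degY q := by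
  have hinj := (Bivariate.swap (R := K)).injective
  rw [degY_eq, degY_eq, degY_eq, map_mul,
    natDegree_mul ((map_ne_zero_iff _ hinj).mpr hp) ((map_ne_zero_iff _ hinj).mpr hq)]

lemma DY_eq_zero_iff [IsDomain K] [CharZero K] {p : Polynomial (Polynomial K)} :
    DY p = 0 ↔ degY p = 0 := by
  rw [degY_eq, ← map_eq_zero_iff _ (Bivariate.swap (R := K)).injective, swap_DY]
  exact derivative_eq_zero

lemma exists_eq_liftX_of_degY_eq_zero {p : Polynomial (Polynomial K)} (h : degY p = 0) :
    ∃ p' : Polynomial K, p = liftX p' := by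
  rw [degY_eq] at h
  obtain ⟨f, hf⟩ := natDegree_eq_zero.mp h
  refine ⟨f, ?_⟩
  rw [liftX, ← Bivariate.swap_C, hf, Bivariate.swap_swap_apply]

end Bivariate

/-! ### Linear algebra -/

/-- The polynomial in `K[y][x]` with prescribed coefficients in a box of `A × B` monomials. -/
noncomputable def boxPoly (K : Type*) [Field K] (A B : ℕ) :
    (Fin A → degreeLT K B) →ₗ[K] Polynomial (Polynomial K) where
  toFun f := ∑ i : Fin A, monomial (i : ℕ) (f i : Polynomial K)
  map_add' f g := by simp [Finset.sum_add_distrib]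
  map_smul' a f := by
    simp only [Pi.smul_apply, Submodule.coe_smul, RingHom.id_apply, Finset.smul_sum, smul_monomial]

section Box

variable {K : Type*} [Field K] {A B : ℕ}

lemma boxPoly_apply (f : Fin A → degreeLT K B) :
    boxPoly K A B f = ∑ i : Fin A, monomial (i : ℕ) (f i : Polynomial K) := rfl

lemma coeff_boxPoly (f : Fin A → degreeLT K B) (n : ℕ) :
    (boxPoly K A B f).coeff n = if h : n < A then (f ⟨n, h⟩ : Polynomial K) else 0 := by
  rw [boxPoly_apply, finsetSum_coeff]
  simp only [coeff_monomial]
  split_ifs with h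
  · rw [Finset.sum_eq_single ⟨n, h⟩]
    · simp
    · intro b _ hb
      exact if_neg fun hbn => hb (Fin.ext hbn)
    · simp
  · exact Finset.sum_eq_zero fun i _ => if_neg fun hi : (i : ℕ) = n => h (hi ▸ i.2)

lemma boxPoly_injective : Function.Injective (boxPoly K A B) := by
  intro f g hfg
  funext i
  have := congrArg (fun p => p.coeff (i : ℕ)) hfg
  simpa [coeff_boxPoly] using this

lemma degLE_boxPoly (f : Fin A → degreeLT K B) : DegLE (boxPoly K A B f) (A - 1) := by
  intro n hn
  rw [coeff_boxPoly, dif_neg (by omega)]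

lemma yDegLE_boxPoly (f : Fin A → degreeLT K B) : YDegLE (boxPoly K A B f) (B - 1) := by
  rw [YDegLE.iff_coeff]
  intro n m hm
  rw [coeff_boxPoly]
  split_ifs with h
  · have := mem_degreeLT.mp (f ⟨n, h⟩).2
    exact coeff_eq_zero_of_degree_lt (this.trans_le (by exact_mod_cast (by omega : B ≤ m)))
  · exact coeff_zero _

/-- The coefficients of a bivariate polynomial inside a box. -/
noncomputable def boxCoeff (K : Type*) [Field K] (A B : ℕ) :
    Polynomial (Polynomial K) →ₗ[K] (Fin A × Fin B → K) where
  toFun p ij := (p.coeff ij.1).coeff ij.2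
  map_add' p q := by ext; simp
  map_smul' a p := by ext; simp

lemma eq_zero_of_boxCoeff_eq_zero {p : Polynomial (Polynomial K)} (h : boxCoeff K A B p = 0)
    (hx : DegLE p (A - 1)) (hy : YDegLE p (B - 1)) : p = 0 := by
  ext n m
  rw [coeff_zero, coeff_zero]
  by_cases hn : n < A
  · by_cases hm : m < B
    · exact congrFun h (⟨n, hn⟩, ⟨m, hm⟩)
    · exact YDegLE.iff_coeff.mp hy n m (by omega)
  · rw [hx n (by omega), coeff_zero]

lemma finrank_degreeLT (n : ℕ) : Module.finrank K (degreeLT K n) = n := by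
  rw [(degreeLTEquiv K n).finrank_eq, Module.finrank_fin_fun]

instance finite_degreeLT (n : ℕ) : Module.Finite K (degreeLT K n) :=
  Module.Finite.equiv (degreeLTEquiv K n).symm

/-- `liftX` as a linear map. -/
noncomputable def liftXLinear (K : Type*) [Field K] :
    Polynomial K →ₗ[K] Polynomial (Polynomial K) where
  toFun := liftX
  map_add' p q := by simp [liftX]
  map_smul' a p := by ext1 n; simp [liftX, smul_eq_C_mul]

lemma YDegLE.liftX (p : Polynomial K) : YDegLE (liftX p) 0 := by
  rw [YDegLE.iff_coeff]
  intro n m hm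
  rw [_root_.liftX, coeff_map, coeff_C, if_neg (by omega)]

/-- The counting argument: if there are more unknown coefficients than linear conditions,
then there is a nontrivial solution, and it does not come from the kernel in `Q`. -/
lemma exists_solution_of_count {r d A B C D Z : ℕ} {J : Type*} [Fintype J]
    (M : ℕ → Polynomial (Polynomial K)) (F G : Polynomial (Polynomial K))
    (cond : (Fin (r + 1) → degreeLT K (d + 1)) →ₗ[K] (J → K))
    (hcond : ∀ p, cond p = 0 → DegLE (∑ j, liftX (p j : Polynomial K) * M j) (C - 1))
    (hM : ∀ j ≤ r, YDegLE (M j) (D - 1))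
    (hQ : ∀ Q, DegLE Q (A - 1) → YDegLE Q (B - 1) →
      DegLE (DY Q * F + Q * G) (C - 1) ∧ YDegLE (DY Q * F + Q * G) (D - 1))
    (extra : Polynomial (Polynomial K) →ₗ[K] (Fin Z → K))
    (hker : ∀ Q, DegLE Q (A - 1) → YDegLE Q (B - 1) → DY Q * F + Q * G = 0 → extra Q = 0 → Q = 0)
    (hcount : Fintype.card J + C * D + Z < (r + 1) * (d + 1) + A * B) :
    ∃ p : Fin (r + 1) → degreeLT K (d + 1), p ≠ 0 ∧ ∃ Q : Polynomial (Polynomial K),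
      ∑ j, liftX (p j : Polynomial K) * M j = DY Q * F + Q * G := by
  classical
  let Pmap : (Fin (r + 1) → degreeLT K (d + 1)) →ₗ[K] Polynomial (Polynomial K) :=
    ∑ j : Fin (r + 1), (LinearMap.mulRight K (M j)) ∘ₗ (liftXLinear K) ∘ₗ
      (degreeLT K (d + 1)).subtype ∘ₗ LinearMap.proj j
  have hP : ∀ p, Pmap p = ∑ j, liftX (p j : Polynomial K) * M j := by
    intro p
    simp only [Pmap, LinearMap.sum_apply]
    rfl
  let Qmap : Polynomial (Polynomial K) →ₗ[K] Polynomial (Polynomial K) :=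
    (LinearMap.mulRight K F) ∘ₗ (derivY K : Polynomial (Polynomial K) →ₗ[K] _) +
      LinearMap.mulRight K G
  have hQm : ∀ Q, Qmap Q = DY Q * F + Q * G := fun Q => rfl
  let Φ : ((Fin (r + 1) → degreeLT K (d + 1)) × (Fin A → degreeLT K B)) →ₗ[K]
      (J → K) × (Fin C × Fin D → K) × (Fin Z → K) :=
    (cond ∘ₗ LinearMap.fst K _ _).prod
      (((boxCoeff K C D) ∘ₗ (Pmap ∘ₗ LinearMap.fst K _ _ -
          Qmap ∘ₗ boxPoly K A B ∘ₗ LinearMap.snd K _ _)).prod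
        (extra ∘ₗ boxPoly K A B ∘ₗ LinearMap.snd K _ _))
  have hΦ : LinearMap.ker Φ ≠ ⊥ := by
    apply LinearMap.ker_ne_bot_of_finrank_lt
    simp only [Module.finrank_prod, Module.finrank_pi_fintype, finrank_degreeLT,
      Module.finrank_self, Finset.sum_const, Finset.card_univ, Fintype.card_fin,
      Fintype.card_prod, smul_eq_mul, mul_one]
    linarith
  obtain ⟨⟨p, f⟩, hpf, hne⟩ := (Submodule.ne_bot_iff _).mp hΦ
  rw [LinearMap.mem_ker] at hpf
  have h1 : cond p = 0 := congrArg (fun t => t.1) hpf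
  have h2 : boxCoeff K C D (Pmap p - Qmap (boxPoly K A B f)) = 0 :=
    congrArg (fun t => t.2.1) hpf
  have h3 : extra (boxPoly K A B f) = 0 := congrArg (fun t => t.2.2) hpf
  have hbx := degLE_boxPoly f
  have hby := yDegLE_boxPoly f
  have h4 : Pmap p - Qmap (boxPoly K A B f) = 0 := by
    apply eq_zero_of_boxCoeff_eq_zero h2
    · rw [hP, hQm]
      exact (hcond p h1).sub (hQ _ hbx hby).1
    · rw [hP, hQm]
      refine YDegLE.sub (YDegLE.sum fun j _ => ?_) (hQ _ hbx hby).2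
      simpa using (YDegLE.liftX _).mul (hM j (Nat.lt_succ_iff.mp j.2))
  rw [sub_eq_zero, hP, hQm] at h4
  refine ⟨p, ?_, _, h4⟩
  rintro rfl
  apply hne
  have h5 : boxPoly K A B f = 0 := by
    refine hker _ hbx hby ?_ h3
    rw [← h4]
    exact Finset.sum_eq_zero fun j _ => by simp [liftX]
  have h6 : f = 0 := boxPoly_injective (by rw [h5, map_zero])
  rw [h6]
  rfl

lemma eq_zero_of_DY_mul_eq [CharZero K] {Q Q₀ : Polynomial (Polynomial K)} (hQ₀ : Q₀ ≠ 0)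
    (h : DY Q * Q₀ = Q * DY Q₀) (hc : (Bivariate.swap Q).coeff (degY Q₀) = 0) : Q = 0 := by
  by_contra hQ
  have hinj := (Bivariate.swap (R := K)).injective
  set P := Bivariate.swap Q with hPdef
  set P₀ := Bivariate.swap Q₀ with hP₀def
  have hP : P ≠ 0 := (map_ne_zero_iff _ hinj).mpr hQ
  have hP₀ : P₀ ≠ 0 := (map_ne_zero_iff _ hinj).mpr hQ₀
  have h' : derivative P * P₀ = P * derivative P₀ := by
    rw [hPdef, hP₀def, ← swap_DY, ← swap_DY, ← map_mul, ← map_mul, h]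
  rw [degY_eq, ← hP₀def] at hc
  have e1 : ∀ T : Polynomial (Polynomial K),
      (X * derivative T).coeff T.natDegree = T.natDegree * T.leadingCoeff := by
    intro T
    rcases hn : T.natDegree with _ | n
    · simp
    · rw [coeff_X_mul, coeff_derivative, leadingCoeff, hn]; push_cast; ring
  have e2 : ∀ T : Polynomial (Polynomial K), (X * derivative T).natDegree ≤ T.natDegree := by
    intro T
    refine natDegree_le_iff_coeff_eq_zero.mpr fun n hn => ?_
    cases n with
    | zero => simp
    | succ n => rw [coeff_X_mul, coeff_derivative, coeff_eq_zero_of_natDegree_lt hn, zero_mul]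
  have h'' : (X * derivative P) * P₀ = P * (X * derivative P₀) := by
    linear_combination X * h'
  have hcoef := congrArg (fun T => T.coeff (P.natDegree + P₀.natDegree)) h''
  simp only [coeff_mul_add_eq_of_natDegree_le (e2 P) le_rfl,
    coeff_mul_add_eq_of_natDegree_le le_rfl (e2 P₀),
    e1, coeff_natDegree] at hcoef
  have h7 : ((P.natDegree : Polynomial K) - P₀.natDegree) *
      (P.leadingCoeff * P₀.leadingCoeff) = 0 := by linear_combination hcoef
  rcases mul_eq_zero.mp h7 with h8 | h8
  · have h9 : P.natDegree = P₀.natDegree := by exact_mod_cast sub_eq_zero.mp h8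
    rw [← h9, coeff_natDegree, leadingCoeff_eq_zero] at hc
    exact hP hc
  · exact mul_ne_zero (leadingCoeff_ne_zero.mpr hP) (leadingCoeff_ne_zero.mpr hP₀) h8

/-- The coefficients of `y ^ n` of a bivariate polynomial. -/
noncomputable def yCoeff (K : Type*) [Field K] (A n : ℕ) :
    Polynomial (Polynomial K) →ₗ[K] (Fin A → K) where
  toFun p i := (p.coeff i).coeff n
  map_add' p q := by ext; simp
  map_smul' a p := by ext; simp

/-- The solutions of a first-order homogeneous equation in `y` form a space of rank at most one
over `K[x]`, so that `A` linear conditions cut it down to zero. -/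
lemma exists_extra_conditions [CharZero K] (A : ℕ) {F : Polynomial (Polynomial K)} (hF : F ≠ 0)
    (G : Polynomial (Polynomial K)) :
    ∃ extra : Polynomial (Polynomial K) →ₗ[K] (Fin A → K),
      ∀ Q, DegLE Q (A - 1) → DY Q * F + Q * G = 0 → extra Q = 0 → Q = 0 := by
  by_cases hex : ∃ Q₀, Q₀ ≠ 0 ∧ DY Q₀ * F + Q₀ * G = 0
  · obtain ⟨Q₀, hQ₀, hG⟩ := hex
    refine ⟨yCoeff K A (degY Q₀), fun Q hx hQ he => eq_zero_of_DY_mul_eq hQ₀ ?_ ?_⟩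
    · apply mul_right_cancel₀ hF
      linear_combination Q₀ * hQ - Q * hG
    · ext n
      rw [coeff_coeff_swap, coeff_zero]
      by_cases hn : n < A
      · exact congrFun he ⟨n, hn⟩
      · rw [hx n (by omega), coeff_zero]
  · push Not at hex
    exact ⟨0, fun Q _ hQ _ => by_contra fun h => hex Q h hQ⟩

end Box

/-! ### Prime factors and derivations -/

/-- The numerators of the iterated derivatives of `c₀ · H`, where `D H / H = U / V`. -/
noncomputable def iterNumer {K : Type*} [CommRing K]
    (D : Derivation K (Polynomial (Polynomial K)) (Polynomial (Polynomial K)))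
    (V U c₀ : Polynomial (Polynomial K)) : ℕ → Polynomial (Polynomial K)
  | 0 => c₀
  | j + 1 => D (iterNumer D V U c₀ j) * V + iterNumer D V U c₀ j * (U - j * D V)

section Primes

variable {K : Type*} [Field K]
  (D : Derivation K (Polynomial (Polynomial K)) (Polynomial (Polynomial K)))

lemma dvd_derivation_mul {b s : Polynomial (Polynomial K)} (h : ∀ q, Prime q → q ∣ b → q ∣ s) :
    b ∣ D b * s := by
  induction b using UniqueFactorizationMonoid.induction_on_coprime with
  | h0 => simp
  | h1 hu => exact hu.dvd
  | @hpr p i hp =>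
    cases i with
    | zero => simp
    | succ i =>
      obtain ⟨t, rfl⟩ := h p hp (dvd_pow_self p i.succ_ne_zero)
      rw [D.leibniz_pow]
      simp only [Nat.add_sub_cancel, smul_eq_mul, nsmul_eq_mul]
      exact ⟨((i + 1 : ℕ) : Polynomial (Polynomial K)) * D p * t, by ring⟩
  | @hcp x y hxy ihx ihy =>
    obtain ⟨t, ht⟩ := ihx fun q hq hd => h q hq (hd.mul_right _)
    obtain ⟨t', ht'⟩ := ihy fun q hq hd => h q hq (hd.mul_left _)
    rw [D.leibniz]
    simp only [smul_eq_mul]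
    exact ⟨t + t', by linear_combination y * ht + x * ht'⟩

lemma exists_prime_dvd_of_degY_ne_zero {f : Polynomial (Polynomial K)} (hf : f ≠ 0)
    (h : degY f ≠ 0) : ∃ w, Prime w ∧ w ∣ f ∧ degY w ≠ 0 := by
  induction f using UniqueFactorizationMonoid.induction_on_prime with
  | h₁ => exact absurd rfl hf
  | h₂ x hx =>
    exfalso
    obtain ⟨y, hxy⟩ := hx.exists_right_inv
    have hy : y ≠ 0 := by rintro rfl; simp at hxy
    have := degY_mul hf hy
    rw [hxy, degY_eq, map_one, natDegree_one] at this
    omega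
  | h₃ a p ha hp ih =>
    by_cases hp0 : degY p = 0
    · rw [degY_mul hp.ne_zero ha, hp0, zero_add] at h
      obtain ⟨w, hw, hwa, hw0⟩ := ih ha h
      exact ⟨w, hw, hwa.mul_left _, hw0⟩
    · exact ⟨p, hp, dvd_mul_right _ _, hp0⟩

lemma not_dvd_DY [CharZero K] {w : Polynomial (Polynomial K)} (h : degY w ≠ 0) : ¬ w ∣ DY w := by
  rintro ⟨t, ht⟩
  have hDY : DY w ≠ 0 := fun h0 => h (DY_eq_zero_iff.mp h0)
  have hw : w ≠ 0 := by rintro rfl; simp [degY] at h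
  have ht0 : t ≠ 0 := by rintro rfl; exact hDY (by rw [ht, mul_zero])
  have h1 := degY_mul hw ht0
  rw [← ht] at h1
  have h2 : degY (DY w) < degY w := by
    rw [degY_eq, degY_eq, swap_DY]
    rw [degY_eq] at h
    exact natDegree_derivative_lt h
  omega

lemma exists_eq_pow_mul_not_dvd {w f : Polynomial (Polynomial K)} (hw : Prime w) (hf : f ≠ 0) :
    ∃ (n : ℕ) (g : Polynomial (Polynomial K)), f = w ^ n * g ∧ ¬ w ∣ g :=
  (FiniteMultiplicity.of_prime_left hw hf).exists_eq_pow_mul_and_not_dvd.elim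
    fun g hg => ⟨_, g, hg⟩

lemma mul_derivation_pow_mul (w f : Polynomial (Polynomial K)) (s : ℕ) :
    D (w ^ s * f) * w = w ^ s * (s * D w * f + w * D f) := by
  cases s with
  | zero => simp; ring
  | succ s =>
    rw [D.leibniz, D.leibniz_pow]
    simp only [Nat.add_sub_cancel, smul_eq_mul, nsmul_eq_mul]
    ring

lemma derivation_pow_succ_mul (w f : Polynomial (Polynomial K)) (s : ℕ) :
    D (w ^ (s + 1) * f) = w ^ s * ((s + 1 : ℕ) * D w * f + w * D f) := by
  rw [D.leibniz, D.leibniz_pow]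
  simp only [Nat.add_sub_cancel, smul_eq_mul, nsmul_eq_mul]
  ring

lemma dvd_of_dvd_smul {w f : Polynomial (Polynomial K)} {z : K} (hz : z ≠ 0)
    (h : w ∣ z • f) : w ∣ f := by
  have := h.trans (Dvd.intro_left (C (C z⁻¹)) rfl)
  have h2 : C (C z⁻¹) * (z • f) = f := by
    rw [show z • f = C (C z) * f by
      rw [← smul_eq_C_mul, ← algebraMap_eq, algebraMap_smul], ← mul_assoc, ← C_mul, ← C_mul,
      inv_mul_cancel₀ hz]
    simp
  rwa [h2] at this

/-- Proportional logarithmic `y`-derivatives force equal multiplicities. -/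
lemma eq_of_DY_mul_eq [CharZero K] {w S T S₁ T₁ : Polynomial (Polynomial K)} {s t : ℕ}
    (hw : Prime w) (hw0 : degY w ≠ 0) (hS : S = w ^ s * S₁) (hT : T = w ^ t * T₁)
    (hS₁ : ¬ w ∣ S₁) (hT₁ : ¬ w ∣ T₁) (h : DY S * T = S * DY T) : s = t := by
  have e1 := mul_derivation_pow_mul (derivY K) w S₁ s
  have e2 := mul_derivation_pow_mul (derivY K) w T₁ t
  rw [← hS, derivY_apply, derivY_apply, derivY_apply] at e1
  rw [← hT, derivY_apply, derivY_apply, derivY_apply] at e2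
  have h1 : w ^ (s + t) * ((s * DY w * S₁ + w * DY S₁) * T₁) =
      w ^ (s + t) * (S₁ * (t * DY w * T₁ + w * DY T₁)) := by
    rw [pow_add]
    calc _ = (w ^ s * (s * DY w * S₁ + w * DY S₁)) * (w ^ t * T₁) := by ring
      _ = (w ^ s * S₁) * (w ^ t * (t * DY w * T₁ + w * DY T₁)) := by
        rw [← e1, ← e2, ← hS, ← hT]; linear_combination w * h
      _ = _ := by ring
  have h2 := mul_left_cancel₀ (pow_ne_zero _ hw.ne_zero) h1
  by_contra hst
  have h3 : w ∣ ((s : K) - t) • (DY w * S₁ * T₁) := by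
    refine ⟨S₁ * DY T₁ - DY S₁ * T₁, ?_⟩
    rw [sub_smul, Nat.cast_smul_eq_nsmul, Nat.cast_smul_eq_nsmul, nsmul_eq_mul, nsmul_eq_mul]
    linear_combination h2
  have h4 := dvd_of_dvd_smul (sub_ne_zero.mpr (by exact_mod_cast hst)) h3
  rcases hw.dvd_or_dvd h4 with h5 | h5
  · rcases hw.dvd_or_dvd h5 with h6 | h6
    · exact not_dvd_DY hw0 h6
    · exact hS₁ h6
  · exact hT₁ h5

variable {D}

lemma derivation_step {w V V₁ U U₁ N M : Polynomial (Polynomial K)} {v s : ℕ}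
    (hV : V = w ^ (v + 1) * V₁) (hU : U = w ^ v * U₁) (hN : N = w ^ s * M) (j : ℕ) :
    D N * V + N * (U - j * D V) = w ^ (s + v) *
      (D M * (w * V₁) + M * ((s - j * (v + 1 : ℕ)) * D w * V₁ + U₁ - j * w * D V₁)) := by
  have e1 := mul_derivation_pow_mul D w M s
  have e2 := derivation_pow_succ_mul D w V₁ v
  rw [← hN] at e1
  rw [← hV] at e2
  rw [e2]
  have : D N * V = (D N * w) * (w ^ v * V₁) := by rw [hV]; ring
  rw [this, e1, hU, hN]
  push_cast
  ring

lemma exists_residue {w V V₁ U Q₀ Q₁ S : Polynomial (Polynomial K)} {v q n : ℕ} (hw : Prime w)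
    (hV : V = w ^ (v + 1) * V₁) (hQ₀ : Q₀ = w ^ q * Q₁) (hQ₁ : ¬ w ∣ Q₁)
    (hS : D Q₀ * V + Q₀ * (U - n * D V) = S) (hdvd : w ^ (v + 1 + q) ∣ S) :
    ∃ U₁, U = w ^ v * U₁ ∧ w ∣ U₁ - (n * (v + 1 : ℕ) - q) * D w * V₁ := by
  obtain ⟨S₁, hS₁⟩ := hdvd
  have e1 := mul_derivation_pow_mul D w Q₁ q
  have e2 := derivation_pow_succ_mul D w V₁ v
  rw [← hQ₀] at e1
  rw [← hV] at e2
  have h1 : w ^ q * (Q₁ * U) = w ^ q * (w ^ v * (n * Q₁ * ((v + 1 : ℕ) * D w * V₁ + w * D V₁)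
      - (q * D w * Q₁ + w * D Q₁) * V₁ + w * S₁)) := by
    have h2 : D Q₀ * V = (w ^ q * (q * D w * Q₁ + w * D Q₁)) * (w ^ v * V₁) := by
      rw [← e1, hV]; ring
    rw [h2, e2, hQ₀, hS₁] at hS
    linear_combination hS
  have h3 := mul_left_cancel₀ (pow_ne_zero _ hw.ne_zero) h1
  obtain ⟨U₁, hU₁⟩ : w ^ v ∣ U := hw.pow_dvd_of_dvd_mul_left v hQ₁ (Dvd.intro _ h3.symm)
  refine ⟨U₁, hU₁, ?_⟩
  have h4 : w ^ v * (Q₁ * U₁) = w ^ v * (n * Q₁ * ((v + 1 : ℕ) * D w * V₁ + w * D V₁)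
      - (q * D w * Q₁ + w * D Q₁) * V₁ + w * S₁) := by
    rw [← h3, hU₁]; ring
  have h5 := mul_left_cancel₀ (pow_ne_zero _ hw.ne_zero) h4
  refine (hw.dvd_or_dvd (a := Q₁) ⟨n * Q₁ * D V₁ - D Q₁ * V₁ + S₁, ?_⟩).resolve_left hQ₁
  linear_combination h5

lemma pow_dvd_iterNumer {w V V₁ U U₁ : Polynomial (Polynomial K)} {v : ℕ}
    (hV : V = w ^ (v + 1) * V₁) (hU : U = w ^ v * U₁) (c₀ : Polynomial (Polynomial K)) (j : ℕ) :
    w ^ (j * v) ∣ iterNumer D V U c₀ j := by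
  induction j with
  | zero => simp
  | succ j ih =>
    obtain ⟨M, hM⟩ := ih
    rw [iterNumer, derivation_step hV hU hM j]
    exact (pow_dvd_pow w (by rw [Nat.succ_mul])).mul_right _

lemma pow_sub_dvd_iterNumer {w V V₁ U U₁ : Polynomial (Polynomial K)} {v e : ℕ}
    (hV : V = w ^ (v + 1) * V₁) (hU : U = w ^ v * U₁)
    (he : w ∣ U₁ - e * D w * V₁) (c₀ : Polynomial (Polynomial K)) (j : ℕ) :
    w ^ (j * (v + 1) - e) ∣ iterNumer D V U c₀ j := by
  induction j with
  | zero => simp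
  | succ j ih =>
    obtain ⟨M, hM⟩ := ih
    rw [iterNumer, derivation_step hV hU hM j]
    rcases lt_or_ge (j * (v + 1)) e with h | h
    · refine (pow_dvd_pow w ?_).mul_right _
      rw [Nat.succ_mul]; omega
    · obtain ⟨T, hT⟩ := he
      have h1 : ((j * (v + 1) - e : ℕ) : Polynomial (Polynomial K)) =
          j * (v + 1 : ℕ) - e := by push_cast [Nat.cast_sub h]; ring
      refine (pow_dvd_pow w (show (j + 1) * (v + 1) - e ≤ (j * (v + 1) - e + v) + 1 by
        rw [Nat.succ_mul]; omega)).trans ?_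
      rw [pow_succ]
      refine mul_dvd_mul_left _ ⟨D M * V₁ + M * T - j * M * D V₁, ?_⟩
      rw [h1]
      linear_combination M * hT

end Primes

/-! ### The filtration by degree in `x` -/

section Filtration

variable {K E : Type*} [Field K] [Field E] [Algebra K E]
  (ι : Polynomial (Polynomial K) →ₐ[K] E) (H : E) (V : Polynomial (Polynomial K)) (m : ℤ)

/-- The elements `N / V ^ s * H` with `deg_x N ≤ m + s * deg_x V - n`. -/
def xFil (n : ℤ) (s : ℕ) : Submodule K E where
  carrier := {f | ∃ N, DegLE N (m + s * V.natDegree - n) ∧ f * ι V ^ s = ι N * H}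
  zero_mem' := ⟨0, DegLE.zero, by simp⟩
  add_mem' := by
    rintro f g ⟨N, hN, hf⟩ ⟨M, hM, hg⟩
    exact ⟨N + M, hN.add hM, by rw [add_mul, hf, hg, map_add, add_mul]⟩
  smul_mem' := by
    rintro k f ⟨N, hN, hf⟩
    exact ⟨k • N, hN.smul k, by rw [smul_mul_assoc, hf, map_smul, smul_mul_assoc]⟩

variable {ι H V m}

lemma xFil_mono_left {n n' : ℤ} (hn : n' ≤ n) (s : ℕ) : xFil ι H V m n s ≤ xFil ι H V m n' s := by
  rintro f ⟨N, hN, hf⟩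
  exact ⟨N, hN.mono (by linarith), hf⟩

lemma xFil_mono_right (n : ℤ) {s s' : ℕ} (hs : s ≤ s') :
    xFil ι H V m n s ≤ xFil ι H V m n s' := by
  rintro f ⟨N, hN, hf⟩
  obtain ⟨t, rfl⟩ := Nat.exists_eq_add_of_le hs
  refine ⟨N * V ^ t, (hN.mul (DegLE.natDegree.pow t)).mono ?_, ?_⟩
  · push_cast; linarith
  · rw [pow_add, ← mul_assoc, hf, map_mul, map_pow]; ring

lemma X_pow_mul_mem_xFil {n : ℤ} {s : ℕ} {f : E} (hf : f ∈ xFil ι H V m n s) (i : ℕ) :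
    ι X ^ i * f ∈ xFil ι H V m (n - i) s := by
  obtain ⟨N, hN, hf⟩ := hf
  refine ⟨X ^ i * N, ((DegLE.X_pow i).mul hN).mono (by linarith), ?_⟩
  rw [mul_assoc, hf, map_mul, map_pow, mul_assoc]

variable {δ : Derivation K E E} {U : Polynomial (Polynomial K)}

lemma derivation_mul_pow_succ
    {D : Derivation K (Polynomial (Polynomial K)) (Polynomial (Polynomial K))}
    (hδι : ∀ q, δ (ι q) = ι (D q)) (hH : δ H * ι V = H * ι U)
    {f : E} {N : Polynomial (Polynomial K)} {s : ℕ} (hf : f * ι V ^ s = ι N * H) :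
    δ f * ι V ^ (s + 1) = ι (D N * V + N * (U - s * D V)) * H := by
  have h1 := congrArg δ hf
  rw [δ.leibniz, δ.leibniz, δ.leibniz_pow, hδι, hδι] at h1
  simp only [smul_eq_mul, nsmul_eq_mul] at h1
  simp only [map_add, map_mul, map_sub, map_natCast]
  cases s with
  | zero =>
    simp only [Nat.cast_zero, zero_mul, mul_zero, zero_add, pow_zero, one_mul, mul_one,
      sub_zero, pow_one] at h1 hf ⊢
    linear_combination ι V * h1 + ι N * hH
  | succ s =>
    simp only [Nat.add_sub_cancel] at h1
    linear_combination ι V * h1 + ι N * hH - ((s + 1 : ℕ) : E) * ι (D V) * hf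

lemma iterate_mul_pow {D : Derivation K (Polynomial (Polynomial K)) (Polynomial (Polynomial K))}
    (hδι : ∀ q, δ (ι q) = ι (D q)) (hH : δ H * ι V = H * ι U)
    {f : E} {c₀ : Polynomial (Polynomial K)} (hf : f = ι c₀ * H) (j : ℕ) :
    δ^[j] f * ι V ^ j = ι (iterNumer D V U c₀ j) * H := by
  induction j with
  | zero => simpa [iterNumer] using hf
  | succ j ih =>
    rw [Function.iterate_succ_apply', derivation_mul_pow_succ hδι hH ih, iterNumer]

variable (δ ι) in
/-- The Euler operator `x · D_x`. -/
noncomputable def eulerOp : Module.End K E := LinearMap.mulLeft K (ι X) ∘ₗ δ.toLinearMap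

lemma eulerOp_apply (f : E) : eulerOp ι δ f = ι X * δ f := rfl

lemma X_pow_mul_iterate (hδι : ∀ q, δ (ι q) = ι (derivX K q)) (f : E) (j : ℕ) :
    ι X ^ j * δ^[j] f = aeval (eulerOp ι δ) (descPochhammer K j) f := by
  induction j with
  | zero => simp
  | succ j ih =>
    rw [descPochhammer_succ_right, mul_comm (descPochhammer K j), map_mul, Module.End.mul_apply,
      ← ih, map_sub, aeval_X,
      map_natCast, LinearMap.sub_apply, eulerOp_apply, Function.iterate_succ_apply', δ.leibniz,
      δ.leibniz_pow, hδι, Module.End.natCast_apply]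
    simp only [derivX_apply, derivative_X, map_one, smul_eq_mul, nsmul_eq_mul, mul_one]
    cases j with
    | zero => simp
    | succ j => simp only [Nat.add_sub_cancel]; ring

section Euler

variable {ε : K}

lemma degLE_of_euler
    (hU : DegLE (X * U - ε • V) (V.natDegree - 1)) :
    DegLE U (V.natDegree - 1) := by
  refine DegLE.of_X_mul ?_
  have h1 : DegLE (ε • V) (V.natDegree : ℤ) := DegLE.natDegree.smul ε
  simpa using (hU.mono (by linarith)).add h1

lemma derivation_mem_xFil
    (hδι : ∀ q, δ (ι q) = ι (derivX K q)) (hH : δ H * ι V = H * ι U)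
    (hU : DegLE (X * U - ε • V) (V.natDegree - 1))
    {n : ℤ} {s : ℕ} {f : E} (hf : f ∈ xFil ι H V m n s) :
    δ f ∈ xFil ι H V m (n + 1) (s + 1) := by
  obtain ⟨N, hN, hf⟩ := hf
  refine ⟨_, ?_, derivation_mul_pow_succ hδι hH hf⟩
  have hV : DegLE V V.natDegree := DegLE.natDegree
  refine ((hN.derivative.mul hV).mono ?_).add
    ((hN.mul ((degLE_of_euler hU).sub (hV.derivative.natCast_mul s))).mono ?_) <;>
  · push_cast; linarith

lemma iterate_mem_xFil
    (hδι : ∀ q, δ (ι q) = ι (derivX K q)) (hH : δ H * ι V = H * ι U)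
    (hU : DegLE (X * U - ε • V) (V.natDegree - 1))
    {n : ℤ} {s : ℕ} {f : E} (hf : f ∈ xFil ι H V m n s) (j : ℕ) :
    δ^[j] f ∈ xFil ι H V m (n + j) (s + j) := by
  induction j with
  | zero => simpa using hf
  | succ j ih =>
    rw [Function.iterate_succ_apply']
    have := derivation_mem_xFil hδι hH hU ih
    push_cast
    rwa [← add_assoc, ← add_assoc]

lemma euler_sub_mem_xFil
    (hδι : ∀ q, δ (ι q) = ι (derivX K q)) (hH : δ H * ι V = H * ι U)
    (hU : DegLE (X * U - ε • V) (V.natDegree - 1))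
    {n : ℤ} {s : ℕ} {f : E} (hf : f ∈ xFil ι H V m n s) :
    (eulerOp ι δ - algebraMap K _ ((m : K) + ε - n)) f ∈ xFil ι H V m (n + 1) (s + 1) := by
  obtain ⟨N, hN, hf⟩ := hf
  have h1 := derivation_mul_pow_succ hδι hH hf
  have hV : DegLE V V.natDegree := DegLE.natDegree
  refine ⟨(X * derivative N - ((m + s * V.natDegree - n : ℤ) : Polynomial (Polynomial K)) * N) * V
    + (N * (X * U - ε • V)
    - N * ((s : Polynomial (Polynomial K)) *
      (X * derivative V - ((V.natDegree : ℤ) : Polynomial (Polynomial K)) * V))), ?_, ?_⟩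
  · refine ((hN.X_mul_derivative_sub.mul hV).mono ?_).add (((hN.mul hU).mono ?_).sub
      ((hN.mul (hV.X_mul_derivative_sub.natCast_mul s)).mono ?_)) <;>
    · push_cast; linarith
  · rw [LinearMap.sub_apply, eulerOp_apply, Module.algebraMap_end_apply, Algebra.smul_def]
    simp only [derivX_apply, map_add, map_mul, map_sub, map_natCast, map_intCast, map_smul] at h1 ⊢
    rw [Algebra.smul_def]
    push_cast
    linear_combination ι X * h1 - ((m : E) + algebraMap K E ε - n) * ι V * hf

lemma euler_mem_xFil
    (hδι : ∀ q, δ (ι q) = ι (derivX K q)) (hH : δ H * ι V = H * ι U)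
    (hU : DegLE (X * U - ε • V) (V.natDegree - 1))
    {n : ℤ} {s : ℕ} {f : E} (hf : f ∈ xFil ι H V m n s) :
    eulerOp ι δ f ∈ xFil ι H V m n (s + 1) := by
  have h1 := xFil_mono_left (by linarith : n ≤ n + 1) _ (euler_sub_mem_xFil hδι hH hU hf)
  have h2 := Submodule.smul_mem _ ((m : K) + ε - n) (xFil_mono_right n s.le_succ hf)
  rw [LinearMap.sub_apply, Module.algebraMap_end_apply] at h1
  simpa using add_mem h1 h2

lemma aeval_euler_mem_xFil [CharZero K]
    (hδι : ∀ q, δ (ι q) = ι (derivX K q)) (hH : δ H * ι V = H * ι U)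
    (hU : DegLE (X * U - ε • V) (V.natDegree - 1))
    (t : ℕ) : ∀ {n : ℤ} {s e : ℕ} {f : E} {q : Polynomial K},
    f ∈ xFil ι H V m n s → q.natDegree ≤ e → (∀ k < t, q.eval ((m : K) + ε - n - k) = 0) →
    aeval (eulerOp ι δ) q f ∈ xFil ι H V m (n + t) (s + e) := by
  induction t with
  | zero =>
    intro n s e f q hf hq _
    have h1 : ∀ i : ℕ, (eulerOp ι δ ^ i) f ∈ xFil ι H V m n (s + i) := fun i => by
      induction i with
      | zero => simpa using hf
      | succ i ih =>
        rw [pow_succ', Module.End.mul_apply]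
        exact euler_mem_xFil hδι hH hU ih
    rw [aeval_eq_sum_range, LinearMap.sum_apply, Nat.cast_zero, add_zero]
    refine sum_mem fun i hi => Submodule.smul_mem _ _ (xFil_mono_right n ?_ (h1 i))
    rw [mem_range] at hi
    omega
  | succ t ih =>
    intro n s e f q hf hq hroot
    rcases eq_or_ne q 0 with rfl | hq0
    · simp
    have h0 : q.IsRoot ((m : K) + ε - n) := by simpa using hroot 0 t.succ_pos
    obtain ⟨q', rfl⟩ := dvd_iff_isRoot.mpr h0
    have hq' : q' ≠ 0 := right_ne_zero_of_mul hq0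
    rw [natDegree_mul (X_sub_C_ne_zero _) hq', natDegree_X_sub_C] at hq
    obtain ⟨e, rfl⟩ := Nat.exists_eq_add_of_le hq
    have h1 := ih (q := q') (e := q'.natDegree + e) (euler_sub_mem_xFil hδι hH hU hf) (by omega)
      fun k hk => by
        have h2 := hroot (k + 1) (by omega)
        rw [eval_mul, eval_sub, eval_X, eval_C] at h2
        have h3 : ((m : K) + ε - n - (k + 1 : ℕ)) - (m + ε - n) ≠ 0 := by
          rw [show ((m : K) + ε - n - (k + 1 : ℕ)) - (m + ε - n) = -((k + 1 : ℕ) : K) by ring]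
          exact neg_ne_zero.mpr (Nat.cast_ne_zero.mpr k.succ_ne_zero)
        rw [← (mul_eq_zero.mp h2).resolve_left h3]
        congr 1
        push_cast; ring
    rw [mul_comm, map_mul, Module.End.mul_apply, map_sub, aeval_X, aeval_C]
    convert h1 using 2
    · push_cast; ring
    · ring

end Euler

/-- The indicial polynomial of the part of `∑ⱼ pⱼ Dⱼ` that changes the degree in `x` by `d - k`. -/
noncomputable def indicial (r d k : ℕ) :
    (Fin (r + 1) → degreeLT K (d + 1)) →ₗ[K] Polynomial K where
  toFun p := ∑ x : Fin (r + 1) × Fin (d + 1) with d + (x.1 : ℕ) = k + x.2,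
    (p x.1 : Polynomial K).coeff x.2 • descPochhammer K x.1
  map_add' p q := by simp [add_smul, sum_add_distrib]
  map_smul' a p := by simp [mul_smul, smul_sum]

lemma indicial_apply (r d k : ℕ) (p : Fin (r + 1) → degreeLT K (d + 1)) :
    indicial r d k p = ∑ x : Fin (r + 1) × Fin (d + 1) with d + (x.1 : ℕ) = k + x.2,
      (p x.1 : Polynomial K).coeff x.2 • descPochhammer K x.1 := rfl

lemma natDegree_indicial_le (r d k : ℕ) (p : Fin (r + 1) → degreeLT K (d + 1)) :
    (indicial r d k p).natDegree ≤ min r k := by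
  rw [indicial_apply]
  refine natDegree_sum_le_of_forall_le _ _ fun x hx => (natDegree_smul_le _ _).trans ?_
  rw [descPochhammer_natDegree]
  have h1 := (mem_filter.mp hx).2
  have h2 := x.1.2
  have h3 := x.2.2
  omega

/-- The conditions on the indicial polynomials which lower the degree in `x`. -/
noncomputable def indicialCond (r d ψ : ℕ) (ω : K) :
    (Fin (r + 1) → degreeLT K (d + 1)) →ₗ[K] (Fin (ψ + 1) × Fin (ψ + 1) → K) :=
  LinearMap.pi fun x =>
    leval (ω - ((min (x.1 : ℕ) (ψ - x.2) : ℕ) : K)) ∘ₗ indicial r d (x.1 + x.2)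

lemma indicial_eval_eq_zero {r d ψ : ℕ} {ω : K} {p : Fin (r + 1) → degreeLT K (d + 1)}
    (hp : indicialCond r d ψ ω p = 0) {i k : ℕ} (hki : k ≤ i) (hi : i + k ≤ 2 * ψ) :
    (indicial r d i p).eval (ω - k) = 0 := by
  rcases le_total i ψ with h | h
  · have := congrFun hp (⟨k, by omega⟩, ⟨i - k, by omega⟩)
    simp only [indicialCond, LinearMap.pi_apply, LinearMap.comp_apply, Pi.zero_apply] at this
    rwa [min_eq_left (by omega), Nat.add_sub_of_le hki] at this
  · have := congrFun hp (⟨i - ψ + k, by omega⟩, ⟨ψ - k, by omega⟩)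
    simp only [indicialCond, LinearMap.pi_apply, LinearMap.comp_apply, Pi.zero_apply] at this
    rwa [min_eq_right (by omega), show ψ - (ψ - k) = k by omega,
      show i - ψ + k + (ψ - k) = i by omega] at this

lemma indicial_eq_zero [CharZero K] {r d ψ : ℕ} {ω : K} {p : Fin (r + 1) → degreeLT K (d + 1)}
    (hp : indicialCond r d ψ ω p = 0) {i : ℕ} (hi : i ≤ ψ) : indicial r d i p = 0 := by
  refine eq_zero_of_natDegree_lt_card_of_eval_eq_zero (ι := Fin (i + 1)) _
    (f := fun k => ω - ((k : ℕ) : K)) ?_ (fun k => indicial_eval_eq_zero hp ?_ ?_) ?_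
  · intro k l hkl
    simpa [Fin.ext_iff] using hkl
  · omega
  · omega
  · rw [Fintype.card_fin]
    exact Nat.lt_succ_of_le ((natDegree_indicial_le r d i p).trans (min_le_right _ _))

lemma liftX_eq_sum {d : ℕ} (p : degreeLT K (d + 1)) :
    liftX (p : Polynomial K) = ∑ i : Fin (d + 1), (p : Polynomial K).coeff i • X ^ (i : ℕ) := by
  have h1 : (p : Polynomial K) = ∑ i ∈ range (d + 1), C ((p : Polynomial K).coeff i) * X ^ i :=
    as_sum_range_C_mul_X_pow' _ (by
      rw [Nat.lt_succ_iff, natDegree_le_iff_degree_le]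
      exact Order.le_of_lt_succ (mem_degreeLT.mp p.2))
  conv_lhs => rw [h1]
  rw [← Fin.sum_univ_eq_sum_range (fun i => C ((p : Polynomial K).coeff i) * X ^ i), liftX,
    Polynomial.map_sum]
  refine sum_congr rfl fun i _ => ?_
  rw [Polynomial.map_mul, map_C, Polynomial.map_pow, map_X, ← smul_eq_C_mul, ← algebraMap_eq,
    algebraMap_smul]

lemma operator_mem_xFil [CharZero K] (hδι : ∀ q, δ (ι q) = ι (derivX K q))
    (hH : δ H * ι V = H * ι U) {ε : K} (hU : DegLE (X * U - ε • V) (V.natDegree - 1))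
    {h : E} (hh : h ∈ xFil ι H V m 0 0) {r d ψ : ℕ} (hd : 2 * ψ ≤ d)
    {p : Fin (r + 1) → degreeLT K (d + 1)} (hp : indicialCond r d ψ (m + ε) p = 0) :
    ∑ j, ι (liftX (p j : Polynomial K)) * δ^[j] h ∈ xFil ι H V m (2 * ψ + 1 - d) r := by
  have h1 : ∑ j, ι (liftX (p j : Polynomial K)) * δ^[j] h =
      ∑ x : Fin (r + 1) × Fin (d + 1),
        (p x.1 : Polynomial K).coeff x.2 • (ι X ^ (x.2 : ℕ) * δ^[x.1] h) := by
    rw [Fintype.sum_prod_type]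
    refine sum_congr rfl fun j _ => ?_
    rw [liftX_eq_sum, map_sum, sum_mul]
    simp only [map_smul, map_pow, smul_mul_assoc]
  rw [h1, ← sum_filter_add_sum_filter_not univ
    (fun x : Fin (r + 1) × Fin (d + 1) => d + (x.1 : ℕ) ≤ 2 * ψ + x.2)]
  refine add_mem ?_ (sum_mem fun x hx => Submodule.smul_mem _ _ ?_)
  · rw [← sum_fiberwise_of_maps_to (t := range (2 * ψ + 1)) (g := fun x => d + (x.1 : ℕ) - x.2)]
    · refine sum_mem fun k hk => ?_
      have hk' : k ≤ 2 * ψ := by rw [mem_range] at hk; omega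
      have h2 : ∑ x : Fin (r + 1) × Fin (d + 1) with (d + (x.1 : ℕ) ≤ 2 * ψ + x.2) ∧
          d + (x.1 : ℕ) - x.2 = k,
          (p x.1 : Polynomial K).coeff x.2 • (ι X ^ (x.2 : ℕ) * δ^[x.1] h) =
          ι X ^ (d - k) * aeval (eulerOp ι δ) (indicial r d k p) h := by
        rw [indicial_apply, map_sum, LinearMap.sum_apply, mul_sum]
        refine sum_congr (filter_congr fun x _ => ?_) fun x hx => ?_
        · have := x.2.2
          omega
        · rw [map_smul, LinearMap.smul_apply, ← X_pow_mul_iterate hδι, mul_smul_comm, ← mul_assoc,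
            ← pow_add]
          have h3 := (mem_filter.mp hx).2
          rw [show d - k + (x.1 : ℕ) = x.2 by omega]
      rw [filter_filter, h2]
      rcases le_total k ψ with hkψ | hkψ
      · rw [indicial_eq_zero hp hkψ]
        simp
      · have h4 := aeval_euler_mem_xFil hδι hH hU (2 * ψ + 1 - k) hh
          ((natDegree_indicial_le r d k p).trans (min_le_left _ _)) fun l hl => by
            simpa using indicial_eval_eq_zero hp (i := k) (k := l) (by omega) (by omega)
        have h5 := xFil_mono_left (n' := 2 * ψ + 1 - d) (by omega) _ (X_pow_mul_mem_xFil h4 (d - k))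
        rwa [zero_add] at h5
    · intro x hx
      have := (mem_filter.mp hx).2
      have := x.2.2
      rw [mem_range]
      omega
  · have h2 := (mem_filter.mp hx).2
    have h3 := X_pow_mul_mem_xFil (iterate_mem_xFil hδι hH hU hh x.1) x.2
    have := x.1.2
    exact xFil_mono_left (by omega) _ (xFil_mono_right _ (by omega) h3)

end Filtration

/-! ### The logarithmic derivative in standard form -/

section LogDeriv

variable {K : Type*} [Field K]

/-- The numerator of the logarithmic derivative of `exp (a / b) * ∏ ℓ, c ℓ ^ e ℓ` with respect to
the denominator `b * bs * ∏ ℓ, c ℓ`, where `bs` is a squarefree part of `b` and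
`b * B = D b * bs`. -/
noncomputable def logNumer
    (D : Derivation K (Polynomial (Polynomial K)) (Polynomial (Polynomial K)))
    (a b bs B : Polynomial (Polynomial K)) {L : ℕ} (c : Fin L → Polynomial (Polynomial K))
    (e : Fin L → K) : Polynomial (Polynomial K) :=
  (D a * bs - a * B) * ∏ ℓ, c ℓ
    + b * bs * ∑ ℓ, e ℓ • (D (c ℓ) * ∏ j ∈ univ.erase ℓ, c j)

lemma DegLE.sum_smul_mul_prod_erase {L : ℕ} {f g : Fin L → Polynomial (Polynomial K)}
    {n : Fin L → ℤ} {z : ℤ} (e : Fin L → K) (hf : ∀ ℓ, DegLE (f ℓ) (n ℓ))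
    (hg : ∀ ℓ, DegLE (g ℓ) (n ℓ + z)) :
    DegLE (∑ ℓ, e ℓ • (g ℓ * ∏ j ∈ univ.erase ℓ, f j)) (∑ ℓ, n ℓ + z) := by
  refine DegLE.sum fun ℓ _ => DegLE.smul _ (((hg ℓ).mul (DegLE.prod fun j _ => hf j)).mono ?_)
  rw [← add_sum_erase univ n (mem_univ ℓ)]
  linarith

lemma YDegLE.sum_smul_mul_prod_erase {L : ℕ} {f g : Fin L → Polynomial (Polynomial K)}
    {n : Fin L → ℤ} {z : ℤ} (e : Fin L → K) (hf : ∀ ℓ, YDegLE (f ℓ) (n ℓ))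
    (hg : ∀ ℓ, YDegLE (g ℓ) (n ℓ + z)) :
    YDegLE (∑ ℓ, e ℓ • (g ℓ * ∏ j ∈ univ.erase ℓ, f j)) (∑ ℓ, n ℓ + z) := by
  refine YDegLE.sum fun ℓ _ => YDegLE.smul _ (((hg ℓ).mul (YDegLE.prod fun j _ => hf j)).mono ?_)
  rw [← add_sum_erase univ n (mem_univ ℓ)]
  linarith

lemma degY_pow (w : Polynomial (Polynomial K)) (n : ℕ) : degY (w ^ n) = n * degY w := by
  rw [degY_eq, degY_eq, map_pow, natDegree_pow]

lemma degY_prod {L : ℕ} {c : Fin L → Polynomial (Polynomial K)} (hc : ∀ ℓ, c ℓ ≠ 0) :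
    degY (∏ ℓ, c ℓ) = ∑ ℓ, degY (c ℓ) := by
  simp only [degY_eq, map_prod]
  exact natDegree_prod _ _ fun ℓ _ =>
    (map_ne_zero_iff _ Bivariate.swap.injective).mpr (hc ℓ)

section Bounds

variable {a b bs B : Polynomial (Polynomial K)} {L : ℕ} {c : Fin L → Polynomial (Polynomial K)}
  (e : Fin L → K)

lemma degLE_euler_logNumer (hb : b ≠ 0) (hc : ∀ ℓ, c ℓ ≠ 0) (hbs : bs ≠ 0)
    (hB : b * B = derivX K b * bs) (hdeg : a.natDegree ≤ b.natDegree) :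
    DegLE (X * logNumer (derivX K) a b bs B c e
      - (∑ ℓ, e ℓ * ((c ℓ).natDegree : K)) • (b * bs * ∏ ℓ, c ℓ))
      ((b * bs * ∏ ℓ, c ℓ).natDegree - 1) := by
  have hα : (b * bs * ∏ ℓ, c ℓ).natDegree
      = b.natDegree + bs.natDegree + ∑ ℓ, (c ℓ).natDegree := by
    rw [natDegree_mul (mul_ne_zero hb hbs) (prod_ne_zero_iff.mpr fun ℓ _ => hc ℓ),
      natDegree_mul hb hbs, natDegree_prod _ _ fun ℓ _ => hc ℓ]
  have ha' : DegLE a b.natDegree := DegLE.natDegree.mono (by exact_mod_cast hdeg)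
  have hb' : DegLE b b.natDegree := DegLE.natDegree
  have hbs' : DegLE bs bs.natDegree := DegLE.natDegree
  have hc' : ∀ ℓ, DegLE (c ℓ) ((c ℓ).natDegree : ℤ) := fun ℓ => DegLE.natDegree
  have h1 : DegLE (X * (derivative a * bs - a * B)) (b.natDegree + bs.natDegree - 1) := by
    refine DegLE.of_mul hb ?_
    have h2 : b * (X * (derivative a * bs - a * B)) =
        bs * ((X * derivative a - ((b.natDegree : ℤ) : Polynomial (Polynomial K)) * a) * b
          - a * (X * derivative b - ((b.natDegree : ℤ) : Polynomial (Polynomial K)) * b)) := by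
      rw [derivX_apply] at hB
      linear_combination - X * a * hB
    rw [h2]
    refine (hbs'.mul (DegLE.sub (z := b.natDegree + b.natDegree - 1)
      ((ha'.X_mul_derivative_sub.mul hb').mono ?_)
      ((ha'.mul hb'.X_mul_derivative_sub).mono ?_))).mono ?_ <;> linarith
  have h3 : ∀ ℓ, (e ℓ * ((c ℓ).natDegree : K)) • (b * bs * ∏ j, c j) =
      b * bs * e ℓ • ((((c ℓ).natDegree : ℤ) : Polynomial (Polynomial K)) * c ℓ
        * ∏ j ∈ univ.erase ℓ, c j) := fun ℓ => by
    rw [← mul_prod_erase univ c (mem_univ ℓ), mul_smul, Nat.cast_smul_eq_nsmul, nsmul_eq_mul,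
      mul_smul_comm]
    congr 1
    push_cast
    ring
  have h4 : X * logNumer (derivX K) a b bs B c e
      - (∑ ℓ, e ℓ * ((c ℓ).natDegree : K)) • (b * bs * ∏ ℓ, c ℓ) =
      X * (derivative a * bs - a * B) * ∏ ℓ, c ℓ + b * bs * ∑ ℓ, e ℓ • ((X * derivative (c ℓ)
        - (((c ℓ).natDegree : ℤ) : Polynomial (Polynomial K)) * c ℓ)
        * ∏ j ∈ univ.erase ℓ, c j) := by
    rw [sum_smul, sum_congr rfl fun ℓ _ => h3 ℓ, ← mul_sum, logNumer]
    simp only [sub_mul, smul_sub, sum_sub_distrib, derivX_apply]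
    have h5 : ∑ ℓ, e ℓ • (X * derivative (c ℓ) * ∏ j ∈ univ.erase ℓ, c j) =
        X * ∑ ℓ, e ℓ • (derivative (c ℓ) * ∏ j ∈ univ.erase ℓ, c j) := by
      rw [mul_sum]
      exact sum_congr rfl fun ℓ _ => by rw [mul_smul_comm, mul_assoc]
    rw [h5]
    ring
  rw [h4, hα]
  refine ((h1.mul (DegLE.prod fun ℓ _ => hc' ℓ)).mono ?_).add
    (((hb'.mul hbs').mul (DegLE.sum_smul_mul_prod_erase (z := -1) e hc' fun ℓ => ?_)).mono ?_)
  · push_cast; linarith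
  · exact (hc' ℓ).X_mul_derivative_sub
  · push_cast; linarith

lemma yDegLE_logNumer_derivX (hb : b ≠ 0) (hB : b * B = derivX K b * bs) :
    YDegLE (logNumer (derivX K) a b bs B c e)
      (degY bs + max (degY a) (degY b) + ∑ ℓ, degY (c ℓ) : ℕ) := by
  have hB' : YDegLE B (degY bs) := YDegLE.of_mul hb (by
    rw [hB, derivX_apply]; exact YDegLE.degY.derivative.mul YDegLE.degY)
  have ha := (YDegLE.degY (p := a)).mono (w := (max (degY a) (degY b) : ℕ)) (by simp)
  have hb := (YDegLE.degY (p := b)).mono (w := (max (degY a) (degY b) : ℕ)) (by simp)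
  have hc : ∀ ℓ, YDegLE (c ℓ) (degY (c ℓ)) := fun ℓ => YDegLE.degY
  have hbs : YDegLE bs (degY bs) := YDegLE.degY
  refine ((((ha.derivative.mul hbs).sub (ha.mul hB')).mul (YDegLE.prod fun ℓ _ => hc ℓ)).mono
    ?_).add (((hb.mul hbs).mul (YDegLE.sum_smul_mul_prod_erase (z := 0) e hc fun ℓ => ?_)).mono ?_)
  · push_cast; linarith
  · simpa using (hc ℓ).derivative
  · push_cast; linarith

lemma yDegLE_logNumer_derivY (hb : b ≠ 0) (hB : b * B = derivY K b * bs) :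
    YDegLE (logNumer (derivY K) a b bs B c e)
      ((degY bs + max (degY a) (degY b) + ∑ ℓ, degY (c ℓ) : ℕ) - 1) := by
  have hB' : YDegLE B (degY bs - 1) := YDegLE.of_mul hb (by
    rw [hB, derivY_apply]; exact (YDegLE.degY.DY.mul YDegLE.degY).mono (by linarith))
  have ha := (YDegLE.degY (p := a)).mono (w := (max (degY a) (degY b) : ℕ)) (by simp)
  have hb := (YDegLE.degY (p := b)).mono (w := (max (degY a) (degY b) : ℕ)) (by simp)
  have hc : ∀ ℓ, YDegLE (c ℓ) (degY (c ℓ)) := fun ℓ => YDegLE.degY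
  have hbs : YDegLE bs (degY bs) := YDegLE.degY
  refine (((((ha.DY.mul hbs).mono ?_).sub (ha.mul hB')).mul (YDegLE.prod fun ℓ _ => hc ℓ)).mono
    ?_).add (((hb.mul hbs).mul (YDegLE.sum_smul_mul_prod_erase (z := -1) e hc fun ℓ => ?_)).mono ?_)
  · linarith
  · push_cast; linarith
  · exact (hc ℓ).DY
  · push_cast; linarith

lemma degLE_logNumer_derivY (hb : b ≠ 0) (hB : b * B = derivY K b * bs)
    (hdeg : a.natDegree ≤ b.natDegree) :
    DegLE (logNumer (derivY K) a b bs B c e)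
      (bs.natDegree + b.natDegree + ∑ ℓ, (c ℓ).natDegree : ℕ) := by
  have hB' : DegLE B bs.natDegree := DegLE.of_mul hb (by
    rw [hB, derivY_apply]; exact DegLE.natDegree.DY.mul DegLE.natDegree)
  have ha : DegLE a b.natDegree := DegLE.natDegree.mono (by exact_mod_cast hdeg)
  have hb : DegLE b b.natDegree := DegLE.natDegree
  have hc : ∀ ℓ, DegLE (c ℓ) ((c ℓ).natDegree : ℤ) := fun ℓ => DegLE.natDegree
  have hbs : DegLE bs bs.natDegree := DegLE.natDegree
  refine ((((ha.DY.mul hbs).sub (ha.mul hB')).mul (DegLE.prod fun ℓ _ => hc ℓ)).mono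
    ?_).add (((hb.mul hbs).mul (DegLE.sum_smul_mul_prod_erase (z := 0) e hc fun ℓ => ?_)).mono ?_)
  · push_cast; linarith
  · simpa using (hc ℓ).DY
  · push_cast; linarith

end Bounds

lemma derivation_div_mul {E : Type*} [Field E] [Algebra K E]
    {ι : Polynomial (Polynomial K) →ₐ[K] E} (hinj : Function.Injective ι)
    {D : Derivation K (Polynomial (Polynomial K)) (Polynomial (Polynomial K))}
    {δ : Derivation K E E} (hδι : ∀ q, δ (ι q) = ι (D q))
    {a b bs B c₀ : Polynomial (Polynomial K)} {L : ℕ} {c : Fin L → Polynomial (Polynomial K)}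
    {e : Fin L → K} (hb : b ≠ 0) (hc₀ : c₀ ≠ 0) (hB : b * B = D b * bs) {h : E}
    (hδh : δ h * ι (c₀ * b ^ 2 * (∏ ℓ, c ℓ))
      = h * ι (D c₀ * b ^ 2 * (∏ ℓ, c ℓ) + (D a * b - a * D b) * c₀ * (∏ ℓ, c ℓ)
          + c₀ * b ^ 2 * ∑ ℓ, e ℓ • (D (c ℓ) * ∏ j ∈ Finset.univ.erase ℓ, c j))) :
    δ (h / ι c₀) * ι (b * bs * ∏ ℓ, c ℓ) = h / ι c₀ * ι (logNumer D a b bs B c e) := by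
  have hb' : ι b ≠ 0 := (map_ne_zero_iff ι hinj).mpr hb
  have hc₀' : ι c₀ ≠ 0 := (map_ne_zero_iff ι hinj).mpr hc₀
  have hH : h = ι c₀ * (h / ι c₀) := by field_simp
  set H := h / ι c₀
  have hB' := congrArg ι hB
  rw [hH, δ.leibniz, hδι] at hδh
  rw [logNumer]
  simp only [smul_eq_mul, map_add, map_mul, map_sub, map_pow] at hδh hB' ⊢
  refine mul_left_cancel₀ (mul_ne_zero (pow_ne_zero 2 hc₀') hb') ?_
  linear_combination ι bs * hδh + ι c₀ ^ 2 * H * ι a * ι (∏ ℓ, c ℓ) * hB'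

end LogDeriv

/-! ### Rational solutions of the homogeneous equation -/

section Kernel

variable {K : Type*} [Field K]

lemma YDegLE.eq_zero {p : Polynomial (Polynomial K)} (h : YDegLE p (-1)) : p = 0 := by
  ext n m
  simpa using YDegLE.iff_coeff.mp h n m (by omega)

lemma exists_multiple_factor_of_logNumer [CharZero K] {a b bs B c₀ : Polynomial (Polynomial K)}
    {L : ℕ} {c : Fin L → Polynomial (Polynomial K)} {e : Fin L → K}
    (hb : b ≠ 0) (hc : ∀ ℓ, c ℓ ≠ 0) (hbs : bs ≠ 0)
    (hbsb : ∀ q : Polynomial (Polynomial K), Prime q → (q ∣ bs ↔ q ∣ b))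
    (hB : b * B = derivY K b * bs)
    (hφ : ¬ ((∃ a' b' : Polynomial K, b' ≠ 0 ∧ a * liftX b' = b * liftX a') ∧
       (∀ ℓ, degY (c ℓ) = 0 ∨ ∃ n : ℤ, e ℓ = (n : K)) ∧
       (∃ η : ℤ, (η : K) = ∑ ℓ, e ℓ * (degY (c ℓ) : K) ∧ η ≤ (degY c₀ : ℤ))))
    {Q₀ : Polynomial (Polynomial K)} (hQ₀ : Q₀ ≠ 0) {n : ℕ}
    (hQ : DY Q₀ * (b * bs * ∏ ℓ, c ℓ) + Q₀ * (logNumer (derivY K) a b bs B c e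
      - n * DY (b * bs * ∏ ℓ, c ℓ)) = 0) :
    ∃ w, Prime w ∧ degY w ≠ 0 ∧ w ∣ b * bs * ∏ ℓ, c ℓ ∧
      (w ^ 2 ∣ b * bs * ∏ ℓ, c ℓ ∨ ¬ w ^ n ∣ Q₀) := by
  by_contra! hcon
  have hP : ∏ ℓ, c ℓ ≠ 0 := prod_ne_zero_iff.mpr fun ℓ _ => hc ℓ
  have hb0 : degY b = 0 := by
    by_contra h
    obtain ⟨w, hw, hwb, hw0⟩ := exists_prime_dvd_of_degY_ne_zero hb h
    refine (hcon w hw hw0 ((hwb.mul_right _).mul_right _)).1 ?_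
    rw [pow_two]
    exact (mul_dvd_mul hwb ((hbsb w hw).mpr hwb)).mul_right _
  have hbs0 : degY bs = 0 := by
    by_contra h
    obtain ⟨w, hw, hwb, hw0⟩ := exists_prime_dvd_of_degY_ne_zero hbs h
    refine (hcon w hw hw0 ((hwb.mul_left _).mul_right _)).1 ?_
    rw [pow_two]
    exact (mul_dvd_mul ((hbsb w hw).mp hwb) hwb).mul_right _
  have hDb : DY b = 0 := DY_eq_zero_iff.mpr hb0
  have hDbs : DY bs = 0 := DY_eq_zero_iff.mpr hbs0
  have hB0 : B = 0 := by
    rw [derivY_apply, hDb, zero_mul] at hB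
    exact (mul_eq_zero.mp hB).resolve_left hb
  subst hB0
  have hDa : DY a = 0 := by
    refine YDegLE.eq_zero (YDegLE.of_mul (mul_ne_zero hQ₀ (mul_ne_zero hbs hP)) ?_)
    have h1 : DY (b * bs * ∏ ℓ, c ℓ) = b * bs * DY (∏ ℓ, c ℓ) := by
      rw [← derivY_apply, Derivation.leibniz, Derivation.leibniz]
      simp [hDb, hDbs]
    have h2 : Q₀ * (bs * ∏ ℓ, c ℓ) * DY a = 0 - (b * bs) * (DY Q₀ * ∏ ℓ, c ℓ
        + Q₀ * ((∑ ℓ, e ℓ • (DY (c ℓ) * ∏ j ∈ univ.erase ℓ, c j)) - n * DY (∏ ℓ, c ℓ))) := by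
      rw [h1, logNumer] at hQ
      simp only [derivY_apply] at hQ
      linear_combination hQ
    rw [h2, degY_mul hQ₀ (mul_ne_zero hbs hP), degY_mul hbs hP, hbs0, degY_prod hc]
    have hc' : ∀ ℓ, YDegLE (c ℓ) (degY (c ℓ)) := fun ℓ => YDegLE.degY
    have hP' : YDegLE (∏ ℓ, c ℓ) (∑ ℓ, (degY (c ℓ) : ℤ)) := YDegLE.prod fun ℓ _ => hc' ℓ
    have hb' : YDegLE b 0 := by simpa [hb0] using YDegLE.degY (p := b)
    have hbs' : YDegLE bs 0 := by simpa [hbs0] using YDegLE.degY (p := bs)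
    have hQ' : YDegLE Q₀ (degY Q₀) := YDegLE.degY
    have hz : YDegLE (0 : Polynomial (Polynomial K))
        ((degY Q₀ + (0 + ∑ ℓ, degY (c ℓ)) : ℕ) + -1) := by simp [YDegLE, DegLE.zero]
    refine hz.sub (((hb'.mul hbs').mul (YDegLE.add (z := degY Q₀ + ∑ ℓ, (degY (c ℓ) : ℤ) - 1)
      ((hQ'.DY.mul hP').mono (by linarith)) ((hQ'.mul (YDegLE.sub
      (YDegLE.sum_smul_mul_prod_erase (z := -1) e hc' fun ℓ => (hc' ℓ).DY)
      (hP'.DY.natCast_mul n))).mono (by linarith)))).mono ?_)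
    push_cast
    linarith
  have hres : ∀ ℓ, degY (c ℓ) = 0 ∨ ∃ z : ℤ, e ℓ = (z : K) ∧ z ≤ 0 := fun ℓ => by
    refine or_iff_not_imp_left.mpr fun h => ?_
    obtain ⟨w, hw, ⟨c', hc'⟩, hw0⟩ := exists_prime_dvd_of_degY_ne_zero (hc ℓ) h
    set R := ∏ j ∈ univ.erase ℓ, c j with hR
    have hprod : ∏ j, c j = w * c' * R := by rw [← hc', hR, mul_prod_erase univ c (mem_univ ℓ)]
    have hV : b * bs * ∏ j, c j = w ^ (0 + 1) * (b * bs * c' * R) := by rw [hprod]; ring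
    obtain ⟨hw2, hwn⟩ := hcon w hw hw0 (by rw [hV, zero_add, pow_one]; exact dvd_mul_right _ _)
    obtain ⟨q, Q₁, hQ₁, hwQ₁⟩ := exists_eq_pow_mul_not_dvd hw hQ₀
    have hnq : n ≤ q := by
      by_contra hlt
      obtain ⟨k, rfl⟩ := Nat.exists_eq_add_of_lt (not_le.mp hlt)
      rw [hQ₁, add_assoc, pow_add] at hwn
      exact hwQ₁ ((dvd_pow_self w k.succ_ne_zero).trans
        ((mul_dvd_mul_iff_left (pow_ne_zero q hw.ne_zero)).mp hwn))
    have hV₁ : ¬ w ∣ b * bs * c' * R := by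
      rintro ⟨t, ht⟩
      exact hw2 ⟨t, by rw [hV, ht]; ring⟩
    obtain ⟨U₁, hU₁, hdvd⟩ := exists_residue (D := derivY K) hw hV hQ₁ hwQ₁ hQ (dvd_zero _)
    rw [pow_zero, one_mul] at hU₁
    have h1 : w ∣ logNumer (derivY K) a b bs 0 c e - e ℓ • (DY w * (b * bs * c' * R)) := by
      have h2 : w ∣ ∑ i ∈ univ.erase ℓ, e i • (DY (c i) * ∏ j ∈ univ.erase i, c j) := by
        refine dvd_sum fun i hi => ?_
        have h3 : w ∣ ∏ j ∈ univ.erase i, c j :=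
          (Dvd.intro c' hc'.symm).trans (dvd_prod_of_mem c
            (mem_erase.mpr ⟨(mem_erase.mp hi).1.symm, mem_univ ℓ⟩))
        rw [← algebraMap_smul (Polynomial (Polynomial K)) (e i), smul_eq_mul]
        exact (h3.mul_left _).mul_left _
      obtain ⟨t, ht⟩ := h2
      have h4 : DY (c ℓ) = DY w * c' + w * DY c' := by
        rw [hc', ← derivY_apply, Derivation.leibniz]
        simp only [derivY_apply, smul_eq_mul]
        ring
      refine ⟨b * bs * (e ℓ • (DY c' * R) + t), ?_⟩
      rw [logNumer]
      simp only [derivY_apply, hDa]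
      rw [← add_sum_erase univ _ (mem_univ ℓ), ht, ← hR, h4]
      simp only [← algebraMap_smul (Polynomial (Polynomial K)) (e ℓ), smul_eq_mul]
      ring
    have h5 : w ∣ (e ℓ - ((n : K) - q)) • (DY w * (b * bs * c' * R)) := by
      rw [hU₁] at h1
      convert dvd_sub hdvd h1 using 1
      simp only [← algebraMap_smul (Polynomial (Polynomial K)) (e ℓ - ((n : K) - q)),
        ← algebraMap_smul (Polynomial (Polynomial K)) (e ℓ), smul_eq_mul, derivY_apply, map_sub,
        map_natCast]
      push_cast
      ring
    refine ⟨(n : ℤ) - q, ?_, by omega⟩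
    by_contra hne
    rcases hw.dvd_or_dvd (dvd_of_dvd_smul (fun h0 => hne (by
      push_cast; exact sub_eq_zero.mp h0)) h5) with h6 | h6
    · exact not_dvd_DY hw0 h6
    · exact hV₁ h6
  refine hφ ⟨?_, fun ℓ => (hres ℓ).imp_right fun ⟨z, hz, _⟩ => ⟨z, hz⟩, ?_⟩
  · obtain ⟨a', ha'⟩ := exists_eq_liftX_of_degY_eq_zero (DY_eq_zero_iff.mp hDa)
    obtain ⟨b', hb'⟩ := exists_eq_liftX_of_degY_eq_zero hb0
    refine ⟨a', b', ?_, by rw [ha', hb', mul_comm]⟩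
    rintro rfl
    exact hb (by simp [hb', liftX])
  · have h1 : ∀ ℓ, ∃ z : ℤ, e ℓ * (degY (c ℓ) : K) = z ∧ z ≤ 0 := fun ℓ => by
      rcases hres ℓ with h0 | ⟨z, hz, hz0⟩
      · exact ⟨0, by simp [h0], le_rfl⟩
      · exact ⟨z * degY (c ℓ), by push_cast; rw [hz],
          mul_nonpos_of_nonpos_of_nonneg hz0 (by positivity)⟩
    choose z hz hz0 using h1
    refine ⟨∑ ℓ, z ℓ, by push_cast; exact (sum_congr rfl fun ℓ _ => hz ℓ).symm,
      (sum_nonpos fun ℓ _ => hz0 ℓ).trans (by positivity)⟩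

lemma pow_dvd_of_commute [CharZero K] {E : Type*} [Field E] [Algebra K E]
    {ι : Polynomial (Polynomial K) →ₐ[K] E} (hinj : Function.Injective ι)
    {δx δy : Derivation K E E} (hx : ∀ q, δx (ι q) = ι (derivX K q))
    (hy : ∀ q, δy (ι q) = ι (derivY K q)) (hcomm : ∀ u, δx (δy u) = δy (δx u))
    {H : E} (hH : H ≠ 0) {V Ux Uy : Polynomial (Polynomial K)}
    (hHx : δx H * ι V = H * ι Ux) (hHy : δy H * ι V = H * ι Uy)
    {Q₀ w V₁ Q₁ : Polynomial (Polynomial K)} {n s q : ℕ} (hQ₀ : Q₀ ≠ 0)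
    (hQ : DY Q₀ * V + Q₀ * (Uy - n * DY V) = 0) (hw : Prime w) (hw0 : degY w ≠ 0)
    (hV : V = w ^ s * V₁) (hV₁ : ¬ w ∣ V₁) (hQ₁ : Q₀ = w ^ q * Q₁) (hwQ₁ : ¬ w ∣ Q₁) :
    w ^ (s + q) ∣ derivX K Q₀ * V + Q₀ * (Ux - n * derivX K V) := by
  have hV0 : V ≠ 0 := by
    rintro rfl
    rcases mul_eq_zero.mp hV.symm with h | h
    · exact pow_ne_zero _ hw.ne_zero h
    · exact hV₁ (h ▸ dvd_zero _)
  have hιV : ι V ≠ 0 := (map_ne_zero_iff ι hinj).mpr hV0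
  have hιQ : ι Q₀ ≠ 0 := (map_ne_zero_iff ι hinj).mpr hQ₀
  set S := derivX K Q₀ * V + Q₀ * (Ux - n * derivX K V) with hS
  set g := ι Q₀ * H / ι V ^ n with hg
  have hgV : g * ι V ^ n = ι Q₀ * H := by rw [hg]; field_simp
  have hg0 : g ≠ 0 := div_ne_zero (mul_ne_zero hιQ hH) (pow_ne_zero _ hιV)
  have hgy : δy g = 0 := by
    have h1 := derivation_mul_pow_succ hy hHy hgV
    rw [derivY_apply, derivY_apply, hQ, map_zero, zero_mul] at h1
    exact (mul_eq_zero.mp h1).resolve_right (pow_ne_zero _ hιV)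
  have hgx : δx g * ι (V * Q₀) = g * ι S := by
    have h1 := derivation_mul_pow_succ hx hHx hgV
    rw [← hS] at h1
    refine mul_right_cancel₀ (pow_ne_zero n hιV) ?_
    rw [map_mul]
    linear_combination ι Q₀ * h1 - ι S * hgV
  have hSy : DY S * (V * Q₀) = S * DY (V * Q₀) := by
    have h1 := congrArg δy hgx
    rw [δy.leibniz, δy.leibniz, ← hcomm, hgy, map_zero, hy, hy] at h1
    simp only [smul_eq_mul, mul_zero, add_zero, derivY_apply] at h1
    refine hinj (mul_left_cancel₀ hg0 ?_)
    rw [map_mul ι (DY S), map_mul ι S]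
    linear_combination (-ι (V * Q₀)) * h1 + ι (DY (V * Q₀)) * hgx
  rcases eq_or_ne S 0 with h0 | h0
  · rw [h0]; exact dvd_zero _
  · obtain ⟨t, S₁, hS₁, hwS₁⟩ := exists_eq_pow_mul_not_dvd hw h0
    rw [← eq_of_DY_mul_eq hw hw0 hS₁ (T := V * Q₀) (T₁ := V₁ * Q₁) (t := s + q)
      (by rw [hV, hQ₁]; ring) hwS₁ (fun h => (hw.dvd_or_dvd h).elim hV₁ hwQ₁) hSy, hS₁]
    exact dvd_mul_right _ _

end Kernel

section Counting

variable {K : Type*} [Field K]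

lemma exists_solution_of_factor [CharZero K] {n d α γ ψ m₀ : ℕ} {C₀ : ℤ} {J : Type*} [Fintype J]
    {V U : Polynomial (Polynomial K)} (N : ℕ → Polynomial (Polynomial K))
    (hVx : DegLE V α) (hVy : YDegLE V γ) (hUx : DegLE U α) (hUy : YDegLE U (γ - 1))
    (hN : ∀ j ≤ n + 1, YDegLE (N j) (m₀ + (n + 1) * γ))
    (cond : (Fin (n + 1 + 1) → degreeLT K (d + 1)) →ₗ[K] (J → K))
    (hcond : ∀ p, cond p = 0 → DegLE (∑ j, liftX (p j : Polynomial K) * N j) (C₀ - 1))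
    {w V₁ U₁ : Polynomial (Polynomial K)} {v κ : ℕ} (hV : V = w ^ (v + 1) * V₁)
    (hU : U = w ^ v * U₁) (hV0 : V ≠ 0) (hdvd : ∀ j ≤ n + 1, w ^ (κ + v) ∣ N j)
    (hκx : κ * w.natDegree ≤ n * α) (hκy : κ * degY w ≤ n * γ) (hvx : v * w.natDegree ≤ α)
    (hvy : v * degY w < γ) (hC₀ : (n + 1) * α ≤ C₀)
    (hcase : γ ≤ ψ + 1 + v * degY w ∨ γ ≤ ψ + 2 ∧ ∀ Q : Polynomial (Polynomial K), Q ≠ 0 →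
      DY (w ^ κ * Q) * V + w ^ κ * Q * (U - n * DY V) ≠ 0)
    (hcount : Fintype.card J + C₀ * (ψ + 1) + α * (m₀ + (n + 1) * γ - ψ) < (n + 2) * (d + 1)) :
    ∃ p : Fin (n + 1 + 1) → degreeLT K (d + 1), p ≠ 0 ∧
      ∃ Q : Polynomial (Polynomial K),
      ∑ j, liftX (p j : Polynomial K) * N j = DY Q * V + Q * (U - n * DY V) := by
  have hw : w ≠ 0 := by
    rintro rfl
    exact hV0 (by rw [hV]; simp)
  have hV₁ : V₁ ≠ 0 := by
    rintro rfl
    exact hV0 (by rw [hV]; simp)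
  zify at hκx hκy hvx hvy hcase
  set wx : ℤ := (w.natDegree : ℤ) with hwx
  set wy : ℤ := (degY w : ℤ) with hwy
  obtain ⟨A, hA⟩ := Int.eq_ofNat_of_zero_le (a := C₀ - α - κ * wx) (by linarith)
  obtain ⟨B, hB⟩ := Int.eq_ofNat_of_zero_le (a := m₀ + n * γ + 2 - κ * wy) (by linarith)
  obtain ⟨C, hC⟩ := Int.eq_ofNat_of_zero_le (a := C₀ - (κ + v) * wx) (by linarith)
  obtain ⟨D, hD⟩ := Int.eq_ofNat_of_zero_le (a := m₀ + (n + 1) * γ + 1 - (κ + v) * wy)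
    (by linarith)
  choose! M hM using hdvd
  set F := w * V₁
  set G := (κ - n * (v + 1 : ℕ)) * DY w * V₁ + U₁ - n * w * DY V₁
  have hFG : ∀ Q : Polynomial (Polynomial K), DY (w ^ κ * Q) * V + w ^ κ * Q * (U - n * DY V) =
      w ^ (κ + v) * (DY Q * F + Q * G) := fun Q =>
    derivation_step (D := derivY K) hV hU rfl n
  have hsum : ∀ p : Fin (n + 1 + 1) → degreeLT K (d + 1),
      ∑ j, liftX (p j : Polynomial K) * N j =
        w ^ (κ + v) * ∑ j, liftX (p j : Polynomial K) * M j := fun p => by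
    rw [mul_sum]
    refine sum_congr rfl fun j _ => ?_
    rw [hM j (Nat.lt_succ_iff.mp j.2)]
    ring
  have hwk : w ^ (κ + v) ≠ 0 := pow_ne_zero _ hw
  have hwκx : DegLE (w ^ κ) (κ * wx) := DegLE.natDegree.pow κ
  have hwκy : YDegLE (w ^ κ) (κ * wy) := YDegLE.degY.pow κ
  obtain ⟨Z, extra, hker, hZ⟩ : ∃ (Z : ℕ) (extra : Polynomial (Polynomial K) →ₗ[K] (Fin Z → K)),
      (∀ Q, DegLE Q (A - 1) → YDegLE Q (B - 1) → DY Q * F + Q * G = 0 → extra Q = 0 → Q = 0) ∧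
      ((Z = A ∧ (γ : ℤ) ≤ ψ + 1 + v * wy) ∨ (Z = 0 ∧ (γ : ℤ) ≤ ψ + 2)) := by
    rcases hcase with h | ⟨h, h'⟩
    · obtain ⟨extra, hextra⟩ := exists_extra_conditions (F := F) A (mul_ne_zero hw hV₁) G
      exact ⟨A, extra, fun Q h1 _ h2 h3 => hextra Q h1 h2 h3, Or.inl ⟨rfl, h⟩⟩
    · refine ⟨0, 0, fun Q _ _ h2 _ => ?_, Or.inr ⟨rfl, h⟩⟩
      by_contra hQ
      exact h' Q hQ (by rw [hFG, h2, mul_zero])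
  have hcount' : Fintype.card J + C * D + Z < (n + 1 + 1) * (d + 1) + A * B := by
    zify
    have h1 : (C : ℤ) * D = A * B + (A * (γ - v * wy - 1) + (α - v * wx) * D) := by
      have e1 : (C : ℤ) = A + (α - v * wx) := by linarith
      have e2 : (B : ℤ) = D - (γ - v * wy - 1) := by linarith
      rw [e1, e2]; ring
    have h2 : (A : ℤ) * (γ - v * wy - 1) + Z ≤ A * (ψ + 1) := by
      have hA0 : (0 : ℤ) ≤ A := by positivity
      have hvw : (0 : ℤ) ≤ v * wy := by positivity
      rcases hZ with ⟨rfl, h⟩ | ⟨rfl, h⟩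
      · nlinarith
      · push_cast
        nlinarith
    have h3 : (A : ℤ) * (ψ + 1) ≤ (C₀ - α) * (ψ + 1) := by
      have : (0 : ℤ) ≤ κ * wx := by positivity
      exact mul_le_mul_of_nonneg_right (by linarith) (by positivity)
    have h4 : ((α : ℤ) - v * wx) * D ≤ α * (m₀ + (n + 1) * γ + 1) := by
      have h5 : (0 : ℤ) ≤ v * wx := by positivity
      have h6 : (0 : ℤ) ≤ (κ + v) * wy := by positivity
      exact mul_le_mul (by linarith) (by linarith) (by positivity) (by positivity)
    linarith
  refine (exists_solution_of_count M F G cond ?_ ?_ ?_ extra hker hcount').imp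
    fun p ⟨hp, Q, hQ⟩ => ⟨hp, w ^ κ * Q, by rw [hsum, hFG, hQ]⟩
  · intro p hp
    refine DegLE.of_mul hwk ?_
    rw [← hsum, natDegree_pow]
    refine (hcond p hp).mono ?_
    push_cast
    linarith
  · intro j hj
    refine YDegLE.of_mul hwk ?_
    rw [← hM j hj, degY_pow]
    refine (hN j hj).mono ?_
    push_cast
    linarith
  · intro Q hQx hQy
    have hQx' := hwκx.mul hQx
    have hQy' := hwκy.mul hQy
    constructor
    · refine DegLE.of_mul hwk ?_
      rw [← hFG, natDegree_pow]
      refine ((hQx'.DY.mul hVx).add (hQx'.mul (hUx.sub (hVx.DY.natCast_mul n)))).mono ?_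
      push_cast
      linarith
    · refine YDegLE.of_mul hwk ?_
      rw [← hFG, degY_pow]
      refine (((hQy'.DY.mul hVy).mono ?_).add
        (hQy'.mul (hUy.sub (hVy.DY.natCast_mul n)))).mono ?_
      · linarith
      · push_cast
        linarith

end Counting

section Arithmetic

lemma two_mul_lt_of_count {α γ ψ w₀ x₀ y₀ r d : ℤ} (hα : 1 ≤ α) (hγ : ψ + 1 ≤ γ) (hw : 0 ≤ w₀)
    (hψ : w₀ ≤ ψ) (hx : 0 ≤ x₀) (hy : 0 ≤ y₀) (hr : ψ < r)
    (h : 2 * ((α * (γ + ψ + 1) - 1) * r + (x₀ + α * y₀ + ψ * (x₀ + 1 - α)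
      - (w₀ + 1) * (ψ - w₀) + 1)) - ψ * (ψ + 3) < 2 * (d * (r - ψ))) : 2 * ψ < d := by
  have h1 : (γ + ψ) * 1 ≤ (γ + ψ) * α := mul_le_mul_of_nonneg_left hα (by linarith)
  have h2 : 2 * ψ + 1 ≤ α * (γ + ψ + 1) - 1 := by nlinarith
  have h3 : 0 ≤ α * y₀ := by positivity
  have h4 : 0 ≤ ψ * x₀ := mul_nonneg (by linarith) hx
  have h5 : ψ * (2 * ψ + 1) ≤ ψ * ((γ + ψ) * α) := mul_le_mul_of_nonneg_left (by linarith)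
    (by linarith)
  have h6 : (2 * ψ + 1) * (r - ψ) ≤ (α * (γ + ψ + 1) - 1) * (r - ψ) :=
    mul_le_mul_of_nonneg_right h2 (by linarith)
  have h7 : (2 * ψ) * (r - ψ) < d * (r - ψ) := by
    nlinarith [sq_nonneg (2 * w₀ + 1 - ψ), sq_nonneg ψ, sq_nonneg (ψ - 1)]
  exact lt_of_mul_lt_mul_right h7 (by linarith)

lemma count_lt {α γ ψ w₀ x₀ y₀ r d : ℤ}
    (h : 2 * ((α * (γ + ψ + 1) - 1) * r + (x₀ + α * y₀ + ψ * (x₀ + 1 - α)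
      - (w₀ + 1) * (ψ - w₀) + 1)) - ψ * (ψ + 3) < 2 * (d * (r - ψ))) :
    (ψ + 1) * (ψ + 1) + (d + x₀ + r * α - 2 * ψ) * (ψ + 1) + α * (y₀ + r * γ - ψ)
      < (r + 1) * (d + 1) := by
  have hprod : ∀ z : ℤ, 0 ≤ z * (z - 1) := fun z => by
    rcases le_or_gt z 0 with hz | hz
    · exact mul_nonneg_of_nonpos_of_nonpos hz (by linarith)
    · exact mul_nonneg hz.le (by linarith)
  nlinarith [hprod w₀, hprod (ψ - w₀ - 1)]

end Arithmetic

/-! ### Existence of telescopers -/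

section Telescoper

variable {K : Type*} [Field K]

lemma YDegLE.iterNumer {V U c₀ : Polynomial (Polynomial K)} {γ y₀ : ℕ} (hV : YDegLE V γ)
    (hU : YDegLE U γ) (hc₀ : YDegLE c₀ y₀) (j : ℕ) :
    YDegLE (iterNumer (derivX K) V U c₀ j) (y₀ + j * γ) := by
  induction j with
  | zero => simpa [_root_.iterNumer] using hc₀
  | succ j ih =>
    rw [_root_.iterNumer, derivX_apply, derivX_apply]
    refine ((ih.derivative.mul hV).add
      (ih.mul (hU.sub (hV.derivative.natCast_mul j)))).mono ?_
    push_cast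
    linarith

variable {E : Type*} [Field E] [Algebra K E] {ι : Polynomial (Polynomial K) →ₐ[K] E}
  {δx δy : Derivation K E E} {H : E} {V Ux Uy c₀ : Polynomial (Polynomial K)}

lemma sum_mul_iterate_mul_pow (hx : ∀ q, δx (ι q) = ι (derivX K q))
    (hHx : δx H * ι V = H * ι Ux) {h : E} (hh : h = ι c₀ * H) {r d : ℕ}
    (p : Fin (r + 1) → degreeLT K (d + 1)) :
    (∑ j, ι (liftX (p j : Polynomial K)) * δx^[j] h) * ι V ^ r =
      ι (∑ j, liftX (p j : Polynomial K) *
        (iterNumer (derivX K) V Ux c₀ j * V ^ (r - (j : ℕ)))) * H := by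
  rw [map_sum, sum_mul, sum_mul]
  refine sum_congr rfl fun j _ => ?_
  have h1 : ι V ^ r = ι V ^ (j : ℕ) * ι V ^ (r - (j : ℕ)) := by
    rw [← pow_add, Nat.add_sub_of_le (Nat.lt_succ_iff.mp j.2)]
  rw [h1, map_mul, map_mul, map_pow]
  linear_combination ι (liftX (p j : Polynomial K)) * ι V ^ (r - (j : ℕ)) *
    iterate_mul_pow hx hHx hh j

set_option maxHeartbeats 1000000 in
lemma exists_numerator_relation [CharZero K] (hinj : Function.Injective ι)
    (hx : ∀ q, δx (ι q) = ι (derivX K q)) (hy : ∀ q, δy (ι q) = ι (derivY K q))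
    (hcomm : ∀ u, δx (δy u) = δy (δx u)) (hH : H ≠ 0)
    (hHx : δx H * ι V = H * ι Ux) (hHy : δy H * ι V = H * ι Uy) (hV0 : V ≠ 0)
    {γ ψ φ n d : ℕ} {ε : K} (hVy : degY V ≤ γ)
    (hUx : DegLE (X * Ux - ε • V) (V.natDegree - 1)) (hUxy : YDegLE Ux γ)
    (hUyx : DegLE Uy V.natDegree) (hUy : YDegLE Uy (γ - 1))
    (hφ : φ ≤ 1) (hψ : ψ + 2 = γ + φ) (hd : 2 * ψ ≤ d)
    (hmult : φ = 0 → ∀ Q₀ : Polynomial (Polynomial K), Q₀ ≠ 0 →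
      DY Q₀ * V + Q₀ * (Uy - n * DY V) = 0 →
      ∃ w, Prime w ∧ degY w ≠ 0 ∧ w ∣ V ∧ (w ^ 2 ∣ V ∨ ¬ w ^ n ∣ Q₀))
    (hcount : ((ψ : ℤ) + 1) * (ψ + 1)
      + (d + c₀.natDegree + (n + 1 : ℕ) * V.natDegree - 2 * ψ) * (ψ + 1)
      + V.natDegree * (degY c₀ + (n + 1 : ℕ) * γ - ψ) < ((n + 1 : ℕ) + 1) * (d + 1)) :
    ∃ p : Fin (n + 1 + 1) → degreeLT K (d + 1), p ≠ 0 ∧ ∃ Q : Polynomial (Polynomial K),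
      ∑ j, liftX (p j : Polynomial K) *
        (iterNumer (derivX K) V Ux c₀ j * V ^ (n + 1 - (j : ℕ))) =
      DY Q * V + Q * (Uy - n * DY V) := by
  have hVx : DegLE V V.natDegree := DegLE.natDegree
  have hVy' : YDegLE V γ := YDegLE.degY.mono (by exact_mod_cast hVy)
  let N : ℕ → Polynomial (Polynomial K) :=
    fun j => iterNumer (derivX K) V Ux c₀ j * V ^ (n + 1 - j)
  have hN : ∀ j ≤ n + 1, YDegLE (N j) (degY c₀ + (n + 1) * γ) := fun j hj => by
    refine ((YDegLE.iterNumer hVy' hUxy YDegLE.degY j).mul (hVy'.pow _)).mono ?_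
    push_cast [Nat.cast_sub hj]
    linarith
  have hcond : ∀ p, indicialCond (n + 1) d ψ ((c₀.natDegree : ℤ) + ε) p = 0 →
      DegLE (∑ j, liftX (p j : Polynomial K) * N j)
        ((d + c₀.natDegree + (n + 1 : ℕ) * V.natDegree - 2 * ψ) - 1) := fun p hp => by
    have hmem : ι c₀ * H ∈ xFil ι H V c₀.natDegree 0 0 :=
      ⟨c₀, DegLE.natDegree.mono (by simp), by simp⟩
    obtain ⟨P, hP, hP'⟩ := operator_mem_xFil hx hHx hUx hmem hd hp
    rw [sum_mul_iterate_mul_pow hx hHx rfl p] at hP'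
    rw [hinj (mul_right_cancel₀ hH hP')]
    refine hP.mono ?_
    push_cast
    linarith
  have hC₀ : ((n : ℤ) + 1) * V.natDegree
      ≤ d + c₀.natDegree + (n + 1 : ℕ) * V.natDegree - 2 * ψ := by
    push_cast
    linarith
  have hcount' : (Fintype.card (Fin (ψ + 1) × Fin (ψ + 1)) : ℤ)
      + (d + c₀.natDegree + (n + 1 : ℕ) * V.natDegree - 2 * ψ) * (ψ + 1)
      + V.natDegree * (degY c₀ + (n + 1) * γ - ψ) < (n + 2) * (d + 1) := by
    rw [Fintype.card_prod, Fintype.card_fin]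
    push_cast at hcount ⊢
    linarith
  by_cases hker : φ = 0 ∧ ∃ Q₀ : Polynomial (Polynomial K), Q₀ ≠ 0 ∧
      DY Q₀ * V + Q₀ * (Uy - n * DY V) = 0
  · obtain ⟨rfl, Q₀, hQ₀, hQ⟩ := hker
    obtain ⟨w, hw, hw0, hwV, hwQ⟩ := hmult rfl Q₀ hQ₀ hQ
    obtain ⟨s, V₁, hV, hwV₁⟩ := exists_eq_pow_mul_not_dvd hw hV0
    obtain ⟨q, Q₁, hQ₁, hwQ₁⟩ := exists_eq_pow_mul_not_dvd hw hQ₀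
    have hdvd := pow_dvd_of_commute hinj hx hy hcomm hH hHx hHy hQ₀ hQ hw hw0 hV hwV₁ hQ₁ hwQ₁
    obtain ⟨v, rfl⟩ : ∃ v, s = v + 1 := Nat.exists_eq_succ_of_ne_zero fun h0 =>
      hwV₁ (by rwa [hV, h0, pow_zero, one_mul] at hwV)
    obtain ⟨U₁, hU₁, hres⟩ := exists_residue hw hV hQ₁ hwQ₁ rfl hdvd
    obtain ⟨W₁, hW₁, -⟩ := exists_residue (D := derivY K) hw hV hQ₁ hwQ₁ hQ (dvd_zero _)
    have hV₁ : V₁ ≠ 0 := by rintro rfl; exact hwV₁ (dvd_zero w)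
    have hwx : (v + 1) * w.natDegree ≤ V.natDegree := by
      rw [hV, natDegree_mul (pow_ne_zero _ hw.ne_zero) hV₁, natDegree_pow]
      exact Nat.le_add_right _ _
    have hwy : (v + 1) * degY w ≤ γ := by
      refine le_trans ?_ hVy
      rw [hV, degY_mul (pow_ne_zero _ hw.ne_zero) hV₁, degY_pow]
      exact Nat.le_add_right _ _
    have hw1 : 1 ≤ degY w := Nat.one_le_iff_ne_zero.mpr hw0
    have hvx : v * w.natDegree ≤ V.natDegree := by nlinarith
    have hvy : v * degY w < γ := by nlinarith
    rcases Nat.eq_zero_or_pos v with rfl | hv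
    · have hqn : q < n := by
        rcases hwQ with h | h
        · rw [hV, zero_add, pow_one, pow_two] at h
          exact absurd ((mul_dvd_mul_iff_left hw.ne_zero).mp h) hwV₁
        · by_contra hlt
          exact h (hQ₁ ▸ (pow_dvd_pow w (not_lt.mp hlt)).mul_right Q₁)
      have hres' : w ∣ U₁ - ((n - q : ℕ) : Polynomial (Polynomial K)) * derivX K w * V₁ := by
        simpa [Nat.cast_sub hqn.le] using hres
      refine exists_solution_of_factor (κ := q + 1) N hVx hVy' hUyx hUy hN _ hcond hV hW₁ hV0 ?_
        ?_ ?_ hvx hvy hC₀ (Or.inr ⟨by omega, fun Q hQ0 hQ' => ?_⟩) hcount'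
      · intro j hj
        have h1 := pow_sub_dvd_iterNumer (D := derivX K) hV hU₁ hres' c₀ j
        have h2 : w ^ (n + 1 - j) ∣ V ^ (n + 1 - j) := pow_dvd_pow_of_dvd hwV _
        have h3 := mul_dvd_mul h1 h2
        rw [← pow_add] at h3
        refine (pow_dvd_pow w ?_).trans h3
        simp only [zero_add, mul_one]
        omega
      · exact Nat.mul_le_mul hqn (by linarith)
      · exact Nat.mul_le_mul hqn (by linarith)
      · obtain ⟨t, Q₂, hQ₂, hwQ₂⟩ := exists_eq_pow_mul_not_dvd hw hQ0
        have h1 : DY Q₀ * (w ^ (q + 1) * Q) = Q₀ * DY (w ^ (q + 1) * Q) := by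
          refine mul_right_cancel₀ hV0 ?_
          linear_combination (w ^ (q + 1) * Q) * hQ - Q₀ * hQ'
        have h2 := eq_of_DY_mul_eq hw hw0 hQ₁ (T₁ := Q₂) (t := q + 1 + t)
          (by rw [hQ₂]; ring) hwQ₁ hwQ₂ h1
        omega
    · refine exists_solution_of_factor (κ := n * v) N hVx hVy' hUyx hUy hN _ hcond hV hW₁ hV0 ?_
        ?_ ?_ hvx hvy hC₀ (Or.inl ?_) hcount'
      · intro j hj
        have h1 := pow_dvd_iterNumer (D := derivX K) hV hU₁ c₀ j
        have h2 : (w ^ v) ^ (n + 1 - j) ∣ V ^ (n + 1 - j) :=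
          pow_dvd_pow_of_dvd ((pow_dvd_pow w v.le_succ).trans (hV ▸ dvd_mul_right _ _)) _
        rw [← pow_mul] at h2
        have h3 := mul_dvd_mul h1 h2
        rw [← pow_add] at h3
        refine (pow_dvd_pow w ?_).trans h3
        obtain ⟨i, hi⟩ := Nat.exists_eq_add_of_le hj
        rw [hi, Nat.add_sub_cancel_left]
        nlinarith
      · rw [mul_assoc]
        exact Nat.mul_le_mul_left n hvx
      · rw [mul_assoc]
        exact Nat.mul_le_mul_left n hvy.le
      · have : 1 ≤ v * degY w := Nat.mul_pos hv hw1
        omega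
  · refine exists_solution_of_factor (κ := 0) (v := 0) (w := 1) (V₁ := V) (U₁ := Uy) N hVx hVy'
      hUyx hUy hN _ hcond (by simp) (by simp) hV0 (by simp) (by simp) (by simp) (by simp) ?_ hC₀
      ?_ hcount'
    · rw [zero_mul]
      omega
    · rcases Nat.eq_zero_or_pos φ with h0 | h0
      · refine Or.inr ⟨by omega, fun Q hQ0 hQ => hker ⟨h0, Q, hQ0, ?_⟩⟩
        simpa using hQ
      · exact Or.inl (by omega)

lemma sum_eq_derivation_div (hinj : Function.Injective ι)
    (hx : ∀ q, δx (ι q) = ι (derivX K q)) (hy : ∀ q, δy (ι q) = ι (derivY K q))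
    (hHx : δx H * ι V = H * ι Ux) (hHy : δy H * ι V = H * ι Uy) (hV0 : V ≠ 0) (hc₀ : c₀ ≠ 0)
    {h : E} (hh : h = ι c₀ * H) {n d : ℕ} {p : Fin (n + 1 + 1) → degreeLT K (d + 1)}
    {Q : Polynomial (Polynomial K)}
    (hQ : ∑ j, liftX (p j : Polynomial K) *
        (iterNumer (derivX K) V Ux c₀ j * V ^ (n + 1 - (j : ℕ))) =
      DY Q * V + Q * (Uy - n * DY V)) :
    ∑ j, ι (liftX (p j : Polynomial K)) * δx^[j] h = δy (ι Q * h / ι (c₀ * V ^ n)) := by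
  have hιV : ι V ≠ 0 := (map_ne_zero_iff ι hinj).mpr hV0
  have hιc : ι c₀ ≠ 0 := (map_ne_zero_iff ι hinj).mpr hc₀
  refine mul_right_cancel₀ (pow_ne_zero (n + 1) hιV) ?_
  have h1 : ι Q * h / ι (c₀ * V ^ n) * ι V ^ n = ι Q * H := by
    rw [hh, map_mul, map_pow]
    field_simp
  rw [sum_mul_iterate_mul_pow hx hHx hh, hQ, derivation_mul_pow_succ hy hHy h1, derivY_apply,
    derivY_apply]

end Telescoper

/-- An additive map satisfying the Leibniz rule and vanishing on the scalars, as a derivation. -/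
noncomputable def derivationOfLeibniz {K E : Type*} [CommRing K] [Field E] [Algebra K E]
    (D : E → E) (hadd : ∀ u v, D (u + v) = D u + D v)
    (hmul : ∀ u v, D (u * v) = D u * v + u * D v) (hK : ∀ k : K, D (algebraMap K E k) = 0) :
    Derivation K E E :=
  Derivation.mk'
    { toFun := D
      map_add' := hadd
      map_smul' := fun k u => by
        rw [Algebra.smul_def, hmul, hK, zero_mul, zero_add, RingHom.id_apply, Algebra.smul_def] }
    fun u v => by
      rw [LinearMap.coe_mk, AddHom.coe_mk, hmul, smul_eq_mul, smul_eq_mul]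
      ring

/-- The degree condition of the main theorem, cleared of denominators. -/
lemma two_mul_lt_of_div_lt {α γ φ x₀ y₀ w₀ ψ : ℕ} {r d : ℤ} (hψ : ψ + 2 = γ + φ) (hr : ψ < r)
    (hd : (((α : ℚ) * (2 * γ - 1 + φ) - 1) * r + ((x₀ + α * y₀ + (γ - 2 + φ) * (x₀ + 1 - α)
      - (1 / 2) * max ((γ : ℚ) - 2 + φ) 0 * (γ + 1 + φ)) - (w₀ + 1) * (γ - 2 + φ - w₀) + 1))
        / (r - (γ + φ - 2)) < d) :
    2 * (((α : ℤ) * (γ + ψ + 1) - 1) * r + (x₀ + α * y₀ + ψ * (x₀ + 1 - α)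
      - (w₀ + 1) * (ψ - w₀) + 1)) - ψ * (ψ + 3) < 2 * (d * (r - ψ)) := by
  have hγ : (γ : ℚ) = ψ + 2 - φ := by
    have : ((ψ + 2 : ℕ) : ℚ) = (γ + φ : ℕ) := by rw [hψ]
    push_cast at this
    linarith
  have hr' : (ψ : ℚ) < r := by exact_mod_cast hr
  have hmax : max ((γ : ℚ) - 2 + φ) 0 = ψ := by
    rw [hγ, show (ψ : ℚ) + 2 - φ - 2 + φ = ψ by ring]
    exact max_eq_left ψ.cast_nonneg
  rw [hmax, div_lt_iff₀ (by linarith)] at hd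
  rw [hγ] at hd
  have h : (2 : ℚ) * (((α : ℚ) * (γ + ψ + 1) - 1) * r + (x₀ + α * y₀ + ψ * (x₀ + 1 - α)
      - (w₀ + 1) * (ψ - w₀) + 1)) - ψ * (ψ + 3) < 2 * (d * (r - ψ)) := by
    rw [hγ]
    linarith
  exact_mod_cast h

theorem thm1_case2prime
    {K : Type*} {E : Type*} [Field K] [CharZero K] [Field E]
    (Dx Dy : E → E)
    (hDxadd : ∀ u v : E, Dx (u + v) = Dx u + Dx v)
    (hDxmul : ∀ u v : E, Dx (u * v) = Dx u * v + u * Dx v)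
    (hDyadd : ∀ u v : E, Dy (u + v) = Dy u + Dy v)
    (hDymul : ∀ u v : E, Dy (u * v) = Dy u * v + u * Dy v)
    (hcomm : ∀ u : E, Dx (Dy u) = Dy (Dx u))
    (ι : Polynomial (Polynomial K) →+* E)
    (hinj : Function.Injective ι)
    (hDxι : ∀ q : Polynomial (Polynomial K), Dx (ι q) = ι (Polynomial.derivative q))
    (hDyι : ∀ q : Polynomial (Polynomial K), Dy (ι q) = ι (DY q))
    (L : ℕ) (a b c0 bs : Polynomial (Polynomial K))
    (c : Fin L → Polynomial (Polynomial K)) (e : Fin L → K)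
    (ha : a ≠ 0) (hb : b ≠ 0) (hc0 : c0 ≠ 0) (hc : ∀ ℓ, c ℓ ≠ 0)
    (hbs : Squarefree bs)
    (hbsb : ∀ q : Polynomial (Polynomial K), Prime q → (q ∣ bs ↔ q ∣ b))
    (h : E) (hh : h ≠ 0)
    (hDxh : Dx h * ι (c0 * b ^ 2 * (∏ ℓ, c ℓ))
      = h * ι (Polynomial.derivative c0 * b ^ 2 * (∏ ℓ, c ℓ)
          + (Polynomial.derivative a * b - a * Polynomial.derivative b) * c0 * (∏ ℓ, c ℓ)
          + c0 * b ^ 2 * ∑ ℓ, e ℓ • (Polynomial.derivative (c ℓ) * ∏ j ∈ Finset.univ.erase ℓ, c j)))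
    (hDyh : Dy h * ι (c0 * b ^ 2 * (∏ ℓ, c ℓ))
      = h * ι (DY c0 * b ^ 2 * (∏ ℓ, c ℓ)
          + (DY a * b - a * DY b) * c0 * (∏ ℓ, c ℓ)
          + c0 * b ^ 2 * ∑ ℓ, e ℓ • (DY (c ℓ) * ∏ j ∈ Finset.univ.erase ℓ, c j)))
    (hce : ∀ ℓ, e ℓ ≠ 0)
    (hndx : 0 < max a.natDegree b.natDegree + ∑ ℓ, (c ℓ).natDegree)
    (hndy : 0 < max (degY a) (degY b) + ∑ ℓ, degY (c ℓ))
    (hdeg : a.natDegree ≤ b.natDegree)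
    (φ3 : ℕ) (hφ3a : φ3 ≤ 1)
    (hφ3 : φ3 = 1 ↔
      ((∃ a' b' : Polynomial K, b' ≠ 0 ∧ a * liftX b' = b * liftX a') ∧
       (∀ ℓ, degY (c ℓ) = 0 ∨ ∃ n : ℤ, e ℓ = (n : K)) ∧
       (∃ η : ℤ, (η : K) = ∑ ℓ, e ℓ * (degY (c ℓ) : K) ∧ η ≤ (degY c0 : ℤ))))
    (w0 : ℕ) (hω : ((c0.natDegree : K) + ∑ ℓ, e ℓ * ((c ℓ).natDegree : K)) = (w0 : K))
    (hγω : (w0 : ℚ) < ((degY bs : ℚ) + (max (degY a) (degY b) : ℚ) + ∑ ℓ, (degY (c ℓ) : ℚ)) - 1 + (φ3 : ℚ))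
    (r d : ℤ)
    (hr : (((degY bs : ℚ) + (max (degY a) (degY b) : ℚ) + ∑ ℓ, (degY (c ℓ) : ℚ)) + (φ3 : ℚ) - 2) + 1 ≤ (r : ℚ))
    (hd : ((((bs.natDegree : ℚ) + (b.natDegree : ℚ) + ∑ ℓ, ((c ℓ).natDegree : ℚ)) * (2 * ((degY bs : ℚ) + (max (degY a) (degY b) : ℚ) + ∑ ℓ, (degY (c ℓ) : ℚ)) - 1 + (φ3 : ℚ)) - 1) * (r : ℚ) + (((c0.natDegree : ℚ) + ((bs.natDegree : ℚ) + (b.natDegree : ℚ) + ∑ ℓ, ((c ℓ).natDegree : ℚ)) * (degY c0 : ℚ)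
        + (((degY bs : ℚ) + (max (degY a) (degY b) : ℚ) + ∑ ℓ, (degY (c ℓ) : ℚ)) - 2 + (φ3 : ℚ)) * ((c0.natDegree : ℚ) + 1 - ((bs.natDegree : ℚ) + (b.natDegree : ℚ) + ∑ ℓ, ((c ℓ).natDegree : ℚ)))
        - (1 / 2) * max (((degY bs : ℚ) + (max (degY a) (degY b) : ℚ) + ∑ ℓ, (degY (c ℓ) : ℚ)) - 2 + (φ3 : ℚ)) 0 * (((degY bs : ℚ) + (max (degY a) (degY b) : ℚ) + ∑ ℓ, (degY (c ℓ) : ℚ)) + 1 + (φ3 : ℚ)))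
        - ((w0 : ℚ) + 1) * (((degY bs : ℚ) + (max (degY a) (degY b) : ℚ) + ∑ ℓ, (degY (c ℓ) : ℚ)) - 2 + (φ3 : ℚ) - (w0 : ℚ)) + 1)) / ((r : ℚ) - (((degY bs : ℚ) + (max (degY a) (degY b) : ℚ) + ∑ ℓ, (degY (c ℓ) : ℚ)) + (φ3 : ℚ) - 2))
            < (d : ℚ)) :
    ∃ p : ℕ → Polynomial K,
      (∃ i ≤ r.toNat, p i ≠ 0) ∧
      (∀ i ≤ r.toNat, ((p i).natDegree : ℤ) ≤ d) ∧
      ∃ u v : Polynomial (Polynomial K), v ≠ 0 ∧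
        ∑ i ∈ Finset.range (r.toNat + 1), ι (liftX (p i)) * Dx^[i] h
          = Dy (ι u * h / ι v) := by
  let iK : Algebra K E := (ι.comp (C.comp C)).toAlgebra
  let ι' : Polynomial (Polynomial K) →ₐ[K] E := { ι with commutes' := fun _ => rfl }
  let δx : Derivation K E E := derivationOfLeibniz Dx hDxadd hDxmul fun k => by
    rw [RingHom.algebraMap_toAlgebra, RingHom.comp_apply, hDxι]
    simp
  let δy : Derivation K E E := derivationOfLeibniz Dy hDyadd hDymul fun k => by
    rw [RingHom.algebraMap_toAlgebra, RingHom.comp_apply, hDyι, ← derivY_apply]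
    exact (congrArg ι ((derivY K).map_algebraMap k)).trans (map_zero ι)
  have hx : ∀ q, δx (ι' q) = ι' (derivX K q) := hDxι
  have hy : ∀ q, δy (ι' q) = ι' (derivY K q) := hDyι
  obtain ⟨Bx, hBx⟩ := dvd_derivation_mul (D := derivX K) fun q hq => (hbsb q hq).mpr
  obtain ⟨By, hBy⟩ := dvd_derivation_mul (D := derivY K) fun q hq => (hbsb q hq).mpr
  have hιc : ι c0 ≠ 0 := (map_ne_zero_iff ι hinj).mpr hc0
  have hH : h / ι c0 ≠ 0 := div_ne_zero hh hιc
  have hHx := derivation_div_mul (ι := ι') hinj hx hb hc0 hBx.symm hDxh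
  have hHy := derivation_div_mul (ι := ι') hinj hy hb hc0 hBy.symm hDyh
  have hP : ∏ ℓ, c ℓ ≠ 0 := prod_ne_zero_iff.mpr fun ℓ _ => hc ℓ
  have hV0 : b * bs * ∏ ℓ, c ℓ ≠ 0 := mul_ne_zero (mul_ne_zero hb hbs.ne_zero) hP
  have hα : (b * bs * ∏ ℓ, c ℓ).natDegree
      = bs.natDegree + b.natDegree + ∑ ℓ, (c ℓ).natDegree := by
    rw [natDegree_mul (mul_ne_zero hb hbs.ne_zero) hP, natDegree_mul hb hbs.ne_zero,
      natDegree_prod _ _ fun ℓ _ => hc ℓ, add_comm b.natDegree]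
  have hγ : degY (b * bs * ∏ ℓ, c ℓ) ≤ degY bs + max (degY a) (degY b) + ∑ ℓ, degY (c ℓ) := by
    rw [degY_mul (mul_ne_zero hb hbs.ne_zero) hP, degY_mul hb hbs.ne_zero, degY_prod fun ℓ => hc ℓ]
    have := le_max_right (degY a) (degY b)
    omega
  have hUx := degLE_euler_logNumer e hb hc hbs.ne_zero hBx.symm hdeg
  have hUxy := yDegLE_logNumer_derivX (a := a) (c := c) e hb hBx.symm
  have hUy := yDegLE_logNumer_derivY (a := a) (c := c) e hb hBy.symm
  have hUyx := degLE_logNumer_derivY (c := c) e hb hBy.symm hdeg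
  rw [← hα] at hUyx
  have hα1 : 1 ≤ (b * bs * ∏ ℓ, c ℓ).natDegree := by
    rw [max_eq_right hdeg] at hndx
    omega
  have hαq : (bs.natDegree : ℚ) + b.natDegree + ∑ ℓ, ((c ℓ).natDegree : ℚ)
      = ((b * bs * ∏ ℓ, c ℓ).natDegree : ℚ) := by
    rw [hα]
    push_cast
    rfl
  have hγq : (degY bs : ℚ) + (max (degY a) (degY b) : ℚ) + ∑ ℓ, (degY (c ℓ) : ℚ)
      = ((degY bs + max (degY a) (degY b) + ∑ ℓ, degY (c ℓ) : ℕ) : ℚ) := by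
    push_cast
    rfl
  rw [hαq, hγq] at hd
  rw [hγq] at hr hγω
  generalize degY bs + max (degY a) (degY b) + ∑ ℓ, degY (c ℓ) = γ at hd hr hγω hγ hUxy hUy
  have hγw : w0 + 2 ≤ γ + φ3 := by
    have : (w0 : ℚ) + 1 < γ + φ3 := by linarith
    exact_mod_cast this
  obtain ⟨ψ, hψ⟩ : ∃ ψ, ψ + 2 = γ + φ3 := ⟨γ + φ3 - 2, by omega⟩
  have hψr : (ψ : ℤ) < r := by
    have hψ' : (ψ : ℚ) + 2 = γ + φ3 := by exact_mod_cast hψ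
    have : (ψ : ℚ) + 1 ≤ r := by linarith
    exact_mod_cast this
  have hineq := two_mul_lt_of_div_lt hψ hψr hd
  have hψd := two_mul_lt_of_count (by exact_mod_cast hα1) (by omega) (by omega) (by omega)
    (by omega) (by omega) hψr hineq
  have hcount := count_lt hineq
  obtain ⟨n, rfl⟩ : ∃ n : ℕ, r = (n + 1 : ℕ) := ⟨r.toNat - 1, by omega⟩
  lift d to ℕ using by omega
  obtain ⟨p, hp, Q, hQ⟩ := exists_numerator_relation hinj hx hy hcomm hH hHx hHy hV0 hγ hUx hUxy
    hUyx hUy hφ3a hψ (by omega) (fun hφ _ hQ₀ hQ => exists_multiple_factor_of_logNumer (c₀ := c0)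
      hb hc hbs.ne_zero hbsb hBy.symm (fun hcond => by simp [hφ3.mpr hcond] at hφ) hQ₀ hQ) hcount
  have hrel := sum_eq_derivation_div hinj hx hy hHx hHy hV0 hc0 (h := h)
    (mul_div_cancel₀ h hιc).symm hQ
  rw [Int.toNat_natCast]
  refine ⟨fun i => if hi : i < n + 1 + 1 then (p ⟨i, hi⟩ : Polynomial K) else 0, ?_, ?_, Q,
    c0 * (b * bs * ∏ ℓ, c ℓ) ^ n, mul_ne_zero hc0 (pow_ne_zero n hV0), ?_⟩
  · obtain ⟨i, hi⟩ := Function.ne_iff.mp hp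
    refine ⟨i, Nat.lt_succ_iff.mp i.2, fun h0 => hi (Subtype.ext ?_)⟩
    simp only [dif_pos i.2] at h0
    exact h0
  · intro i hi
    have hi' : i < n + 1 + 1 := Nat.lt_succ_of_le hi
    have h1 := mem_degreeLT.mp (p ⟨i, hi'⟩).2
    simp only [dif_pos hi', Nat.cast_le]
    exact natDegree_le_iff_degree_le.mpr (Order.le_of_lt_succ h1)
  · rw [Finset.sum_range]
    simp only [Fin.is_lt, dif_pos]
    exact hrel
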